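/- arXiv:1410.6269 — 2 statements merged into one kernel-verified Lean document; each statement's English description precedes it below -/
import Mathlib

section
/- Let ℓ ∈ (1,2] and let f be a Cherry map of exponent ℓ whose rotation number ρ(f) is of bounded type, with q_n the denominators of the convergents of ρ(f). Assume f⁻¹({c}) equals the closure of U, so that for every m ≥ 1 the preimage J_m := f^{−m}({c}) is a closed arc not containing c. For n ≥ 1 set α_n := |(c, J_{q_n})| / (|(c, J_{q_n})| + |J_{q_n}|), where |(c, J_{q_n})| is the distance from c to the nearest endpoint of the arc J_{q_n} and |J_{q_n}| is the length of that arc. Then there exist constants K > 0 and C ∈ (0,1) such that for all sufficiently large n, (−log α_n)/q_{n+1} ≤ K·Cⁿ. -/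
open Filter

noncomputable section

/-- The Gauss map `x ↦ {1/x}`. -/
def gaussMap (x : ℝ) : ℝ := Int.fract (1 / x)

/-- The `n`-th partial quotient (`n ≥ 1`) of the continued fraction expansion
`ρ = [0; a_1, a_2, …]` of an irrational `ρ ∈ (0,1)`. -/
def cfA (ρ : ℝ) (n : ℕ) : ℕ := ⌊1 / (gaussMap^[n - 1] ρ)⌋₊

/-- The denominators of the convergents of `ρ`: `q_0 = 1`, `q_1 = a_1`,
`q_{n+2} = a_{n+2} q_{n+1} + q_n`. -/
def cfQ (ρ : ℝ) : ℕ → ℕ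
  | 0 => 1
  | 1 => cfA ρ 1
  | n + 2 => cfA ρ (n + 2) * cfQ ρ (n + 1) + cfQ ρ n

/-- `ρ` is of bounded type if its partial quotients are bounded. -/
def BoundedType (ρ : ℝ) : Prop := ∃ M : ℕ, ∀ i ≥ 1, cfA ρ i ≤ M

/-- A Cherry map of exponent `ℓ > 1`: a continuous degree-one monotone circle map with a
flat open arc `U = (a,b)`, a `C^∞` diffeomorphism off the closure of `U`, behaving like
`x ↦ x^ℓ` in one-sided `C^∞` local coordinates at the endpoints of `U`, and with no
periodic points (hence irrational rotation number `rho`). -/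
structure CherryMap (ℓ : ℝ) where
  /-- the circle map -/
  f : AddCircle (1 : ℝ) → AddCircle (1 : ℝ)
  /-- a lift of `f` to the real line -/
  F : ℝ → ℝ
  cont : Continuous f
  isLift : ∀ x : ℝ, f (x : AddCircle (1 : ℝ)) = ((F x : ℝ) : AddCircle (1 : ℝ))
  mono : Monotone F
  degree_one : ∀ x : ℝ, F (x + 1) = F x + 1
  /-- left endpoint of the flat arc -/
  a : ℝ
  /-- right endpoint of the flat arc -/
  b : ℝ
  hab : a < b
  hba : b < a + 1
  /-- `f` is constant on the closure of `U = (a,b)` -/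
  flat : ∀ x ∈ Set.Icc a b, F x = F a
  /-- `f` is `C^∞` off the closure of `U` -/
  smooth : ContDiffOn ℝ (⊤ : ℕ∞) F (Set.Ioo b (a + 1))
  /-- `f` is a diffeomorphism onto its image off the closure of `U` -/
  deriv_pos : ∀ x ∈ Set.Ioo b (a + 1), 0 < deriv F x
  /-- radius of the one-sided coordinate neighbourhoods at `a` and `b` -/
  ε : ℝ
  εpos : 0 < ε
  /-- `C^∞` local coordinate at `a` -/
  ψa : ℝ → ℝ
  /-- `C^∞` local coordinate at `b` -/
  ψb : ℝ → ℝ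
  ψa_smooth : ContDiff ℝ (⊤ : ℕ∞) ψa
  ψb_smooth : ContDiff ℝ (⊤ : ℕ∞) ψb
  ψa_zero : ψa 0 = 0
  ψb_zero : ψb 0 = 0
  ψa_deriv_pos : 0 < deriv ψa 0
  ψb_deriv_pos : 0 < deriv ψb 0
  /-- near `b`, `f` is `x ↦ x^ℓ` in the local coordinate -/
  local_b : ∀ t ∈ Set.Ico (0 : ℝ) ε, F (b + t) = F b + ψb (t ^ ℓ)
  /-- near `a`, `f` is `x ↦ x^ℓ` in the local coordinate -/
  local_a : ∀ t ∈ Set.Ico (0 : ℝ) ε, F (a - t) = F a - ψa (t ^ ℓ)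
  /-- `f` has no periodic points -/
  no_periodic_pt : ∀ (x : AddCircle (1 : ℝ)) (n : ℕ), 1 ≤ n → f^[n] x ≠ x
  /-- the rotation number of `f` -/
  rho : ℝ
  rho_mem : rho ∈ Set.Ioo (0 : ℝ) 1
  rho_irrational : Irrational rho
  rho_lim : ∃ m : ℤ, ∀ x : ℝ,
    Tendsto (fun n : ℕ => F^[n] x / n) atTop (nhds (rho + m))

namespace CherryMap

variable {ℓ : ℝ}

/-- The flat arc `U = (a,b)` of a Cherry map, as a subset of the circle. -/
def U (X : CherryMap ℓ) : Set (AddCircle (1 : ℝ)) :=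
  (fun t : ℝ => (t : AddCircle (1 : ℝ))) '' Set.Ioo X.a X.b

/-- The constant value `c = f(a)` of a Cherry map on the closure of its flat arc. -/
def c (X : CherryMap ℓ) : AddCircle (1 : ℝ) := X.f ((X.a : ℝ) : AddCircle (1 : ℝ))

end CherryMap

end

/-- The distance from a point `c` of the circle to the nearest of the two endpoints
`u`, `v` (given by real representatives) of an arc. -/
noncomputable def distToEnds (c : AddCircle (1 : ℝ)) (u v : ℝ) : ℝ :=
  min ‖c - ((u : ℝ) : AddCircle (1 : ℝ))‖ ‖c - ((v : ℝ) : AddCircle (1 : ℝ))‖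

theorem gaussMap_mem {x : ℝ} (hirr : Irrational x) :
    gaussMap x ∈ Set.Ioo (0 : ℝ) 1 ∧ Irrational (gaussMap x) := by
  have h1 : Irrational (gaussMap x) := by
    unfold gaussMap
    rw [Int.fract]
    exact (by simpa using hirr.inv : Irrational (1 / x)).sub_intCast _
  refine ⟨⟨lt_of_le_of_ne (Int.fract_nonneg _) ?_, Int.fract_lt_one _⟩, h1⟩
  intro h
  exact h1 ⟨0, by simpa [gaussMap] using h⟩

theorem gaussMap_iterate_mem {ρ : ℝ} (hρ : ρ ∈ Set.Ioo (0 : ℝ) 1) (hirr : Irrational ρ) (n : ℕ) :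
    gaussMap^[n] ρ ∈ Set.Ioo (0 : ℝ) 1 ∧ Irrational (gaussMap^[n] ρ) := by
  induction n with
  | zero => exact ⟨hρ, hirr⟩
  | succ n ih =>
    rw [Function.iterate_succ_apply']
    exact gaussMap_mem ih.2

theorem gaussMap_iterate_succ {ρ : ℝ} (hρ : ρ ∈ Set.Ioo (0 : ℝ) 1) (hirr : Irrational ρ) (n : ℕ) :
    gaussMap^[n + 1] ρ * gaussMap^[n] ρ = 1 - cfA ρ (n + 1) * gaussMap^[n] ρ := by
  have hg := (gaussMap_iterate_mem hρ hirr n).1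
  have hfl : (cfA ρ (n + 1) : ℝ) = ⌊1 / gaussMap^[n] ρ⌋ := by
    simp only [cfA, Nat.add_sub_cancel]
    exact natCast_floor_eq_intCast_floor (by have := hg.1; positivity)
  rw [Function.iterate_succ_apply', hfl]
  have hmap : ∀ x, gaussMap x = 1 / x - ⌊1 / x⌋ := fun x => rfl
  rw [hmap, sub_mul, one_div_mul_cancel hg.1.ne']

theorem one_le_cfA {ρ : ℝ} (hρ : ρ ∈ Set.Ioo (0 : ℝ) 1) (hirr : Irrational ρ) {n : ℕ} :
    1 ≤ cfA ρ n := by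
  have hg := (gaussMap_iterate_mem hρ hirr (n - 1)).1
  refine Nat.le_floor ?_
  rw [Nat.cast_one, le_div_iff₀ hg.1]
  linarith [hg.2]

theorem cfQ_pos {ρ : ℝ} (hρ : ρ ∈ Set.Ioo (0 : ℝ) 1) (hirr : Irrational ρ) :
    ∀ n, 0 < cfQ ρ n
  | 0 => by simp [cfQ]
  | 1 => one_le_cfA hρ hirr
  | n + 2 => by
    have := cfQ_pos hρ hirr n
    simp only [cfQ]
    positivity

theorem cfQ_add_le {ρ : ℝ} (hρ : ρ ∈ Set.Ioo (0 : ℝ) 1) (hirr : Irrational ρ) (n : ℕ) :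
    cfQ ρ (n + 1) + cfQ ρ n ≤ cfQ ρ (n + 2) := by
  simp only [cfQ]
  gcongr
  exact Nat.le_mul_of_pos_left _ (one_le_cfA hρ hirr)

theorem cfQ_mono {ρ : ℝ} (hρ : ρ ∈ Set.Ioo (0 : ℝ) 1) (hirr : Irrational ρ) :
    Monotone (cfQ ρ) := by
  refine monotone_nat_of_le_succ fun n => ?_
  cases n with
  | zero => exact one_le_cfA hρ hirr
  | succ n => exact le_trans (by omega) (cfQ_add_le hρ hirr n)

theorem cfQ_succ_le {ρ : ℝ} (hρ : ρ ∈ Set.Ioo (0 : ℝ) 1) (hirr : Irrational ρ) {A : ℕ}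
    (hA : ∀ i ≥ 1, cfA ρ i ≤ A) (n : ℕ) : cfQ ρ (n + 1) ≤ (A + 1) * cfQ ρ n := by
  cases n with
  | zero =>
    have := hA 1 le_rfl
    simp only [cfQ]
    omega
  | succ n =>
    have h1 := cfQ_mono hρ hirr n.le_succ
    have h2 := Nat.mul_le_mul_right (cfQ ρ (n + 1)) (hA (n + 2) (by omega))
    simp only [cfQ] at *
    linarith

theorem le_cfQ {ρ : ℝ} (hρ : ρ ∈ Set.Ioo (0 : ℝ) 1) (hirr : Irrational ρ) (n : ℕ) :
    n ≤ cfQ ρ n := by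
  induction n using Nat.twoStepInduction with
  | zero => simp
  | one => exact one_le_cfA hρ hirr
  | more n _ ih =>
    have := cfQ_add_le hρ hirr n
    have := cfQ_pos hρ hirr n
    omega

/-- The sequences `P n / q n` converging to `τ` alternately from both sides, with error terms
`β n = |q n * τ - P n|`, as for the convergents of the continued fraction of `τ`. -/
structure IsConvergents (τ : ℝ) (q : ℕ → ℕ) (P : ℕ → ℤ) (β : ℕ → ℝ) : Prop where
  q_pos : ∀ n, 0 < q n
  q_add_le : ∀ n, q (n + 1) + q n ≤ q (n + 2)
  q_mono : Monotone q
  le_q : ∀ n, n ≤ q n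
  β_pos : ∀ n, 0 < β n
  β_lt_one : ∀ n, β n < 1
  β_succ_lt : ∀ n, β (n + 1) < β n
  error : ∀ n, q n * τ - P n = (-1) ^ n * β n
  det : ∀ n, q (n + 1) * β n + q n * β (n + 1) = 1

theorem exists_isConvergents {ρ : ℝ} (hρ : ρ ∈ Set.Ioo (0 : ℝ) 1) (hirr : Irrational ρ) (k : ℤ) :
    ∃ P β, IsConvergents (ρ + k) (cfQ ρ) P β := by
  let g : ℕ → ℝ := fun n => gaussMap^[n] ρ
  have hg : ∀ n, 0 < g n ∧ g n < 1 := fun n => (gaussMap_iterate_mem hρ hirr n).1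
  have hgs : ∀ n, g (n + 1) * g n = 1 - cfA ρ (n + 1) * g n := gaussMap_iterate_succ hρ hirr
  let β : ℕ → ℝ := fun n => ∏ i ∈ Finset.range (n + 1), g i
  have hβs : ∀ n, β (n + 1) = β n * g (n + 1) := fun n => Finset.prod_range_succ _ _
  have hβ0 : β 0 = ρ := by simp [β, g]
  have hβ : ∀ n, 0 < β n := fun n => Finset.prod_pos fun i _ => (hg i).1
  have hβ1 : β 1 = 1 - cfA ρ 1 * ρ := by
    have := hgs 0
    rw [hβs, hβ0, mul_comm]
    simpa [g] using this
  have hβ2 : ∀ n, β (n + 2) = β n - cfA ρ (n + 2) * β (n + 1) := fun n => by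
    rw [hβs (n + 1), hβs n]
    linear_combination β n * hgs (n + 1)
  let p : ℕ → ℤ := fun n =>
    (Nat.rec (motive := fun _ => ℤ × ℤ) (0, 1)
      (fun n z => (z.2, cfA ρ (n + 2) * z.2 + z.1)) n).1
  have hp2 : ∀ n, p (n + 2) = cfA ρ (n + 2) * p (n + 1) + p n := fun n => rfl
  have herr : ∀ n, cfQ ρ n * ρ - p n = (-1) ^ n * β n := fun n => by
    induction n using Nat.twoStepInduction with
    | zero => simp [cfQ, p, hβ0]
    | one =>
      simp only [cfQ, hβ1]
      simp [p]
    | more n h0 h1 =>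
      rw [hβ2, hp2]
      simp only [cfQ]
      push_cast
      linear_combination h0 + cfA ρ (n + 2) * h1
  have hlt : ∀ n, β (n + 1) < β n := fun n => by
    rw [hβs]
    exact mul_lt_of_lt_one_right (hβ n) (hg _).2
  refine ⟨fun n => p n + cfQ ρ n * k, β, cfQ_pos hρ hirr, cfQ_add_le hρ hirr, cfQ_mono hρ hirr,
    le_cfQ hρ hirr, hβ, fun n => ?_, hlt, fun n => ?_, fun n => ?_⟩
  · exact (antitone_nat_of_succ_le (fun n => (hlt n).le) (Nat.zero_le n)).trans_lt (hβ0 ▸ hρ.2)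
  · push_cast
    linear_combination herr n
  · induction n with
    | zero => simp [cfQ, hβ0, hβ1]
    | succ n ih =>
      rw [hβ2]
      simp only [cfQ]
      push_cast
      linear_combination ih

namespace IsConvergents

variable {τ : ℝ} {q : ℕ → ℕ} {P : ℕ → ℤ} {β : ℕ → ℝ}

theorem abs_error (hc : IsConvergents τ q P β) (n : ℕ) : |q n * τ - P n| = β n := by
  rw [hc.error, abs_mul, abs_pow, abs_neg, abs_one, one_pow, one_mul, abs_of_pos (hc.β_pos n)]

theorem q_mul_β_lt (hc : IsConvergents τ q P β) (n : ℕ) : q (n + 1) * β n < 1 := by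
  have h1 := hc.det n
  have h2 : (0 : ℝ) < q n := by exact_mod_cast hc.q_pos n
  have := mul_pos h2 (hc.β_pos (n + 1))
  linarith

theorem one_le_q_mul_β (hc : IsConvergents τ q P β) (n : ℕ) : 1 ≤ 2 * (q (n + 1) * β n) := by
  have h1 := hc.det n
  have h2 : (q n : ℝ) ≤ q (n + 1) := by exact_mod_cast hc.q_mono n.le_succ
  have h3 : (q n : ℝ) * β (n + 1) ≤ q (n + 1) * β n :=
    mul_le_mul h2 (hc.β_succ_lt n).le (hc.β_pos _).le (by positivity)
  linarith

theorem isCoprime (hc : IsConvergents τ q P β) (n : ℕ) : IsCoprime (P n) (q n : ℤ) := by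
  have h : (q n : ℝ) * P (n + 1) - q (n + 1) * P n = (-1) ^ n := by
    have h1 := hc.error n
    have h2 := hc.error (n + 1)
    have h3 := hc.det n
    rw [pow_succ] at h2
    linear_combination (-1 : ℝ) ^ n * h3 + q (n + 1) * h1 - q n * h2
  have h' : (q n : ℤ) * P (n + 1) - q (n + 1) * P n = (-1) ^ n := by exact_mod_cast h
  have hs : ((-1 : ℤ) ^ n) * (-1) ^ n = 1 := by rw [← mul_pow]; simp
  exact ⟨-(q (n + 1)) * (-1) ^ n, P (n + 1) * (-1) ^ n, by linear_combination (-1) ^ n * h' + hs⟩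

theorem abs_error_mul_le (hc : IsConvergents τ q P β) (n : ℕ) : |q n * τ - P n| * q n ≤ 1 := by
  rw [hc.abs_error]
  have h2 : (q n : ℝ) ≤ q (n + 1) := by exact_mod_cast hc.q_mono n.le_succ
  have := mul_le_mul_of_nonneg_left h2 (hc.β_pos n).le
  linarith [hc.q_mul_β_lt n]

theorem two_mul_q_le (hc : IsConvergents τ q P β) (n : ℕ) : 2 * q n ≤ q (n + 2) := by
  have := hc.q_add_le n
  have := hc.q_mono n.le_succ
  simp only [Nat.succ_eq_add_one] at this
  omega

/-- Multiples `i * τ` with `1 ≤ i ≤ q m` stay away from the integers. -/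
theorem two_mul_β_lt_abs (hc : IsConvergents τ q P β) {m i : ℕ} (hi : 1 ≤ i) (him : i ≤ q m)
    (k : ℤ) : 2 * β (m + 5) < |i * τ - k| := by
  have hne : (i : ℤ) * P (m + 2) - q (m + 2) * k ≠ 0 := by
    intro h0
    have hd : (q (m + 2) : ℤ) ∣ i * P (m + 2) := ⟨k, by linarith⟩
    have hd' := (hc.isCoprime (m + 2)).symm.dvd_of_dvd_mul_right hd
    have := Nat.le_of_dvd hi (Int.natCast_dvd_natCast.1 hd')
    have := hc.two_mul_q_le m
    have := hc.q_pos m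
    omega
  have h1 : (1 : ℝ) ≤ |(i : ℝ) * P (m + 2) - q (m + 2) * k| := by
    exact_mod_cast Int.one_le_abs hne
  have h2 : (i : ℝ) * P (m + 2) - q (m + 2) * k =
      q (m + 2) * (i * τ - k) - i * (q (m + 2) * τ - P (m + 2)) := by ring
  have hq : (0 : ℝ) < q (m + 2) := by exact_mod_cast hc.q_pos _
  rw [h2] at h1
  have h3 := h1.trans (abs_sub _ _)
  rw [abs_mul, abs_mul, hc.abs_error, Nat.abs_cast, Nat.abs_cast] at h3
  have h4 : (2 : ℝ) * q m ≤ q (m + 3) := by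
    exact_mod_cast (hc.two_mul_q_le m).trans (hc.q_mono (by omega))
  have h5 : (4 : ℝ) * q (m + 2) ≤ q (m + 6) := by
    have h6 : 2 * q (m + 2) ≤ q (m + 4) := hc.two_mul_q_le (m + 2)
    have h7 : 2 * q (m + 4) ≤ q (m + 6) := hc.two_mul_q_le (m + 4)
    exact_mod_cast (by omega : 4 * q (m + 2) ≤ q (m + 6))
  have h6 := hc.q_mul_β_lt (m + 2)
  have h7 := hc.q_mul_β_lt (m + 5)
  have h8 : 2 * (i * β (m + 2)) < 1 := by
    have h9 : (i : ℝ) ≤ q m := by exact_mod_cast him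
    have := mul_le_mul_of_nonneg_right (by linarith : 2 * (i : ℝ) ≤ q (m + 3)) (hc.β_pos (m + 2)).le
    linarith
  have h9 := mul_le_mul_of_nonneg_right h5 (hc.β_pos (m + 5)).le
  by_contra! hcon
  have := mul_le_mul_of_nonneg_left hcon hq.le
  linarith

end IsConvergents

/-- Among the first `q` points of an orbit of the rotation by `τ ≈ P / q`, at most
`q * (v - u) + 3` lie in a given arc of length `v - u`. -/
theorem card_rotation_mem_Icc_le {q : ℕ} {P : ℤ} {τ : ℝ} (hq : 0 < q) (hcop : IsCoprime P (q : ℤ))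
    (happ : |q * τ - P| * q ≤ 1) (θ : ℝ) {u v : ℝ} (huv : u ≤ v) {S : Finset ℕ}
    (hS : ∀ i ∈ S, i < q ∧ ∃ k : ℤ, θ + i * τ + k ∈ Set.Icc u v) :
    (S.card : ℝ) ≤ q * (v - u) + 3 := by
  have hq' : (0 : ℝ) < q := by exact_mod_cast hq
  choose! hlt k hk using hS
  let N : ℕ → ℤ := fun i => P * i + q * k i
  have hinj : Set.InjOn N S := by
    intro i hi j hj hij
    have hd : (q : ℤ) ∣ P * (i - j) := ⟨k j - k i, by simp only [N] at hij; linarith⟩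
    have hd' := hcop.symm.dvd_of_dvd_mul_left hd
    have h1 := hlt i hi
    have h2 := hlt j hj
    have := Int.eq_zero_of_abs_lt_dvd hd' (by rw [abs_lt]; constructor <;> omega)
    omega
  have hmaps : ∀ i ∈ S, N i ∈ Finset.Icc ⌈q * (u - θ) - 1⌉ ⌊q * (v - θ) + 1⌋ := by
    intro i hi
    obtain ⟨h1, h2⟩ := hk i hi
    have h3 : (N i : ℝ) = q * (θ + i * τ + k i) - q * θ - i * (q * τ - P) := by
      simp only [N]
      push_cast
      ring
    have h4 : |(i : ℝ) * (q * τ - P)| ≤ 1 := by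
      rw [abs_mul, Nat.abs_cast, mul_comm]
      refine le_trans (mul_le_mul_of_nonneg_left ?_ (abs_nonneg _)) happ
      exact_mod_cast (hlt i hi).le
    have h5 := abs_le.1 h4
    have h6 := mul_le_mul_of_nonneg_left h1 hq'.le
    have h7 := mul_le_mul_of_nonneg_left h2 hq'.le
    rw [Finset.mem_Icc, Int.ceil_le, Int.le_floor, h3]
    constructor <;> linarith
  have hcard := Finset.card_le_card_of_injOn N hmaps hinj
  rw [Int.card_Icc] at hcard
  have h1 := Int.floor_le ((q : ℝ) * (v - θ) + 1)
  have h2 := Int.le_ceil ((q : ℝ) * (u - θ) - 1)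
  have h3 := mul_nonneg hq'.le (sub_nonneg.2 huv)
  have h4 : (S.card : ℤ) ≤ max (⌊q * (v - θ) + 1⌋ + 1 - ⌈q * (u - θ) - 1⌉) 0 := by omega
  have h5 : (S.card : ℝ) ≤ max ((⌊q * (v - θ) + 1⌋ : ℝ) + 1 - ⌈q * (u - θ) - 1⌉) 0 := by
    exact_mod_cast h4
  refine h5.trans (max_le ?_ ?_) <;> linarith

/-- A Koksma-type inequality: if the distribution functions of two weighted finite families of
reals in an interval of length `W` differ by at most `E`, then their weighted sums differ by at
most `E * W`. -/
theorem abs_weighted_sum_sub_le {ι : Type*} (s t : Finset ι) (A B : ι → ℝ)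
    {lo W α γ E : ℝ} (hW : 0 ≤ W) (hA : ∀ i ∈ s, A i ∈ Set.Icc lo (lo + W))
    (hB : ∀ j ∈ t, B j ∈ Set.Icc lo (lo + W))
    (hE : ∀ r, |α * {i ∈ s | r < A i}.card - γ * {j ∈ t | r < B j}.card| ≤ E) :
    |α * ∑ i ∈ s, (A i - lo) - γ * ∑ j ∈ t, (B j - lo)| ≤ E * W := by
  have hII : ∀ y, IntervalIntegrable ((Set.Iio y).indicator (fun _ => (1 : ℝ)))
      MeasureTheory.volume lo (lo + W) := fun y => by
    rw [intervalIntegrable_iff]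
    exact (MeasureTheory.integrableOn_const (by simp)).indicator measurableSet_Iio
  have hIS : ∀ (s : Finset ι) (A : ι → ℝ) (α : ℝ), IntervalIntegrable (fun r => α * ∑ i ∈ s,
      (Set.Iio (A i)).indicator (fun _ => (1 : ℝ)) r) MeasureTheory.volume lo (lo + W) :=
    fun s A α => by
      simpa only [Finset.sum_apply] using
        (IntervalIntegrable.sum s fun i _ => hII (A i)).const_mul α
  have h_ind : ∀ y ∈ Set.Icc lo (lo + W),
      ∫ r in lo..(lo + W), (Set.Iio y).indicator (fun _ => (1 : ℝ)) r = y - lo := by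
    rintro y ⟨hy1, hy2⟩
    rw [intervalIntegral.integral_of_le (by linarith),
      MeasureTheory.setIntegral_indicator measurableSet_Iio, MeasureTheory.setIntegral_const]
    have : Set.Ioc lo (lo + W) ∩ Set.Iio y = Set.Ioo lo y := by
      ext r
      simp only [Set.mem_inter_iff, Set.mem_Ioc, Set.mem_Iio, Set.mem_Ioo]
      constructor
      · rintro ⟨⟨h1, _⟩, h2⟩
        exact ⟨h1, h2⟩
      · rintro ⟨h1, h2⟩
        exact ⟨⟨h1, by linarith⟩, h2⟩
    rw [this]
    simp [hy1]
  have hcount : ∀ (s : Finset ι) (A : ι → ℝ) (r : ℝ),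
      (({i ∈ s | r < A i}.card : ℕ) : ℝ) =
        ∑ i ∈ s, (Set.Iio (A i)).indicator (fun _ => (1 : ℝ)) r := by
    intro s A r
    rw [Finset.card_filter]
    push_cast
    exact Finset.sum_congr rfl fun i _ => by simp [Set.indicator_apply]
  have hsum : α * ∑ i ∈ s, (A i - lo) - γ * ∑ j ∈ t, (B j - lo) =
      ∫ r in lo..(lo + W), (α * ∑ i ∈ s, (Set.Iio (A i)).indicator (fun _ => (1 : ℝ)) r -
        γ * ∑ j ∈ t, (Set.Iio (B j)).indicator (fun _ => (1 : ℝ)) r) := by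
    rw [intervalIntegral.integral_sub, intervalIntegral.integral_const_mul,
      intervalIntegral.integral_const_mul, intervalIntegral.integral_finsetSum fun i _ => hII _,
      intervalIntegral.integral_finsetSum fun i _ => hII _,
      Finset.sum_congr rfl fun i hi => h_ind _ (hA i hi),
      Finset.sum_congr rfl fun j hj => h_ind _ (hB j hj)]
    · exact hIS _ _ _
    · exact hIS _ _ _
  rw [hsum, ← Real.norm_eq_abs]
  refine (intervalIntegral.norm_integral_le_of_norm_le_const (C := E) fun r _ => ?_).trans ?_
  · rw [Real.norm_eq_abs, ← hcount, ← hcount]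
    exact hE r
  · rw [add_sub_cancel_left, abs_of_nonneg hW]

/-- The representative in `[a, a + 1)` of a real number modulo `1`. -/
noncomputable def reduceMod (a x : ℝ) : ℝ := a + Int.fract (x - a)

theorem reduceMod_mem (a x : ℝ) : reduceMod a x ∈ Set.Ico a (a + 1) := by
  have h1 := Int.fract_nonneg (x - a)
  have h2 := Int.fract_lt_one (x - a)
  constructor <;> unfold reduceMod <;> linarith

theorem reduceMod_eq (a x : ℝ) : reduceMod a x = x + ((-⌊x - a⌋ : ℤ) : ℝ) := by
  unfold reduceMod Int.fract
  push_cast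
  ring

/-- `h` is a monotone degree-one semiconjugacy from `F` to the translation by `τ`. -/
structure IsRotationSemiconj (F h : ℝ → ℝ) (τ : ℝ) : Prop where
  mono : Monotone h
  add_one : ∀ x, h (x + 1) = h x + 1
  map : ∀ x, h (F x) = h x + τ

namespace IsRotationSemiconj

variable {F h : ℝ → ℝ} {τ : ℝ}

theorem lt_of_lt (H : IsRotationSemiconj F h τ) {x y : ℝ} (hxy : h x < h y) : x < y := by
  by_contra! hc
  exact absurd (H.mono hc) (not_le.2 hxy)

theorem add_int (H : IsRotationSemiconj F h τ) (x : ℝ) (k : ℤ) : h (x + k) = h x + k := by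
  induction k using Int.induction_on with
  | zero => simp
  | succ n ih =>
    push_cast at *
    rw [← add_assoc, H.add_one, ih, add_assoc]
  | pred n ih =>
    have h1 := H.add_one (x + ((-n - 1 : ℤ) : ℝ))
    have h2 : x + ((-n - 1 : ℤ) : ℝ) + 1 = x + ((-n : ℤ) : ℝ) := by push_cast; ring
    rw [h2, ih] at h1
    push_cast at *
    linarith

theorem iterate (H : IsRotationSemiconj F h τ) (x : ℝ) (n : ℕ) : h (F^[n] x) = h x + n * τ := by
  induction n with
  | zero => simp
  | succ n ih =>
    rw [Function.iterate_succ_apply', H.map, ih]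
    push_cast
    ring

theorem reduceMod_iterate (H : IsRotationSemiconj F h τ) (a x : ℝ) (n : ℕ) :
    ∃ k : ℤ, h (reduceMod a (F^[n] x)) = h x + n * τ + k :=
  ⟨_, by rw [reduceMod_eq, H.add_int, H.iterate]⟩

theorem reduceMod_mem_Icc (H : IsRotationSemiconj F h τ) {a : ℝ} (ha : h a = 0) (x : ℝ) :
    h (reduceMod a x) ∈ Set.Icc (0 : ℝ) 1 := by
  have h1 := H.mono (reduceMod_mem a x).1
  have h2 := H.mono (reduceMod_mem a x).2.le
  rw [H.add_one, ha, zero_add] at h2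
  exact ⟨ha ▸ h1, h2⟩

variable {q : ℕ → ℕ} {P : ℕ → ℤ} {β : ℕ → ℝ}

theorem exists_card_upperSet (H : IsRotationSemiconj F h τ) (hc : IsConvergents τ q P β) {a : ℝ}
    (ha : h a = 0) {p : ℝ → Prop} [DecidablePred p] (hp : ∀ x ∈ Set.Ico a (a + 1),
      ∀ y ∈ Set.Ico a (a + 1), p x → ¬ p y → y ≤ x) :
    ∃ t : ℝ, ∀ x n, |(({i ∈ Finset.range (q n) | p (reduceMod a (F^[i] x))}.card : ℕ) : ℝ)
      - q n * t| ≤ 3 := by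
  let T : Set ℝ := insert 0 (h '' {y | y ∈ Set.Ico a (a + 1) ∧ ¬ p y})
  have hT1 : ∀ s ∈ T, s ≤ 1 := by
    rintro s (rfl | ⟨y, ⟨hy, _⟩, rfl⟩)
    · exact zero_le_one
    · have := H.mono hy.2.le
      rwa [H.add_one, ha, zero_add] at this
  have hbdd : BddAbove T := ⟨1, hT1⟩
  have hu0 : 0 ≤ sSup T := le_csSup hbdd (Set.mem_insert _ _)
  have hu1 : sSup T ≤ 1 := csSup_le ⟨0, Set.mem_insert _ _⟩ hT1
  refine ⟨1 - sSup T, fun x n => ?_⟩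
  have hcard := fun {u v : ℝ} (huv : u ≤ v) (S : Finset ℕ) =>
    card_rotation_mem_Icc_le (hc.q_pos n) (hc.isCoprime n) (hc.abs_error_mul_le n) (h x) huv (S := S)
  have hup := hcard hu1 {i ∈ Finset.range (q n) | p (reduceMod a (F^[i] x))} fun i hi => by
    rw [Finset.mem_filter, Finset.mem_range] at hi
    obtain ⟨k, hk⟩ := H.reduceMod_iterate a x i
    refine ⟨hi.1, k, ?_⟩
    rw [← hk]
    refine ⟨csSup_le ⟨0, Set.mem_insert _ _⟩ ?_, (H.reduceMod_mem_Icc ha _).2⟩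
    rintro s (rfl | ⟨y, ⟨hy, hpy⟩, rfl⟩)
    · exact (H.reduceMod_mem_Icc ha _).1
    · exact H.mono (hp _ (reduceMod_mem a _) y hy hi.2 hpy)
  have hlow := hcard hu0 {i ∈ Finset.range (q n) | ¬ p (reduceMod a (F^[i] x))} fun i hi => by
    rw [Finset.mem_filter, Finset.mem_range] at hi
    obtain ⟨k, hk⟩ := H.reduceMod_iterate a x i
    refine ⟨hi.1, k, ?_⟩
    rw [← hk]
    exact ⟨(H.reduceMod_mem_Icc ha _).1,
      le_csSup hbdd (Set.mem_insert_of_mem _ ⟨_, ⟨reduceMod_mem a _, hi.2⟩, rfl⟩)⟩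
  have htot : ((({i ∈ Finset.range (q n) | p (reduceMod a (F^[i] x))}.card : ℕ) : ℝ) +
      (({i ∈ Finset.range (q n) | ¬ p (reduceMod a (F^[i] x))}.card : ℕ) : ℝ)) = q n := by
    have := Finset.card_filter_add_card_filter_not (s := Finset.range (q n))
      (fun i => p (reduceMod a (F^[i] x)))
    rw [Finset.card_range] at this
    exact_mod_cast this
  rw [abs_le]
  constructor <;> linarith

/-- A Denjoy–Koksma inequality for monotone observables, comparing two orbit segments whose lengths
are denominators of convergents. -/
theorem denjoy_koksma (H : IsRotationSemiconj F h τ) (hc : IsConvergents τ q P β) {a : ℝ}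
    (ha : h a = 0) {φ : ℝ → ℝ} {lo W : ℝ} (hφ : MonotoneOn φ (Set.Ico a (a + 1))) (hW : 0 ≤ W)
    (hlo : ∀ x ∈ Set.Ico a (a + 1), φ x ∈ Set.Icc lo (lo + W)) (x y : ℝ) (m n : ℕ) :
    |q m * ∑ i ∈ Finset.range (q n), φ (reduceMod a (F^[i] x)) -
      q n * ∑ i ∈ Finset.range (q m), φ (reduceMod a (F^[i] y))| ≤ 3 * (q n + q m) * W := by
  have key := abs_weighted_sum_sub_le (Finset.range (q n)) (Finset.range (q m))
    (fun i => φ (reduceMod a (F^[i] x))) (fun i => φ (reduceMod a (F^[i] y))) (α := q m) (γ := q n)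
    (E := 3 * (q n + q m)) hW (fun i _ => hlo _ (reduceMod_mem a _))
    (fun i _ => hlo _ (reduceMod_mem a _)) fun r => by
      obtain ⟨t, ht⟩ := H.exists_card_upperSet hc ha (p := fun x => r < φ x)
        fun x hx y hy hpx hpy => by
          by_contra! hxy
          exact hpy (lt_of_lt_of_le hpx (hφ hx hy hxy.le))
      have h1 := abs_le.1 (ht x n)
      have h2 := abs_le.1 (ht y m)
      have hm : (0 : ℝ) ≤ q m := Nat.cast_nonneg _
      have hn : (0 : ℝ) ≤ q n := Nat.cast_nonneg _
      have h3 := mul_le_mul_of_nonneg_left h1.1 hm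
      have h4 := mul_le_mul_of_nonneg_left h1.2 hm
      have h5 := mul_le_mul_of_nonneg_left h2.1 hn
      have h6 := mul_le_mul_of_nonneg_left h2.2 hn
      rw [abs_le]
      constructor <;> linarith
  refine le_of_eq_of_le ?_ key
  congr 1
  simp only [Finset.sum_sub_distrib, Finset.sum_const, Finset.card_range, nsmul_eq_mul]
  ring

end IsRotationSemiconj

/-- A monotone degree-one map with translation number `τ` is semiconjugate to
the translation by `τ`. -/
theorem exists_isRotationSemiconj {F : ℝ → ℝ} (hmono : Monotone F)
    (hdeg : ∀ x, F (x + 1) = F x + 1) {τ : ℝ}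
    (hlim : Tendsto (fun n : ℕ => F^[n] 0 / n) atTop (nhds τ)) :
    ∃ h, IsRotationSemiconj F h τ := by
  let f : CircleDeg1Lift := ⟨⟨F, hmono⟩, hdeg⟩
  have hf : ∀ n, (⇑(f ^ n) : ℝ → ℝ) = F^[n] := fun n => CircleDeg1Lift.coe_pow f n
  have hτ : f.translationNumber = τ := f.translationNumber_eq_of_tendsto₀ hlim
  have h0 : ∀ n : ℕ, |F^[n] 0 - n * τ| ≤ 1 := fun n => by
    have := (f ^ n).dist_map_zero_translationNumber_le
    rwa [CircleDeg1Lift.translationNumber_pow, hτ, hf, Real.dist_eq] at this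
  have h_ind : ∀ (n : ℕ) (x : ℝ) (k : ℤ), F^[n] (x + k) = F^[n] x + k := fun n x k => by
    rw [← hf]
    exact (f ^ n).map_add_int x k
  have hit : ∀ n : ℕ, Monotone F^[n] := fun n => hmono.iterate n
  let s : ℝ → ℕ → ℝ := fun x n => F^[n] x - n * τ
  have hbdd : ∀ x n, ⌊x⌋ - 1 ≤ s x n ∧ s x n ≤ ⌊x⌋ + 2 := fun x n => by
    have h1 := hit n (Int.floor_le x)
    have h2 := hit n (Int.lt_floor_add_one x).le
    have h3 := h_ind n 0 ⌊x⌋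
    have h4 := h_ind n 0 (⌊x⌋ + 1)
    have h5 := abs_le.1 (h0 n)
    push_cast at h4
    rw [zero_add] at h3 h4
    rw [h3] at h1
    rw [h4] at h2
    simp only [s]
    constructor <;> linarith
  have hup : ∀ x, IsBoundedUnder (· ≤ ·) atTop (s x) := fun x =>
    isBoundedUnder_of ⟨_, fun n => (hbdd x n).2⟩
  have hlow : ∀ x, IsCoboundedUnder (· ≤ ·) atTop (s x) := fun x =>
    IsBoundedUnder.isCoboundedUnder_le (isBoundedUnder_of ⟨_, fun n => (hbdd x n).1⟩)
  refine ⟨fun x => limsup (s x) atTop, fun x y hxy => ?_, fun x => ?_, fun x => ?_⟩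
  · refine limsup_le_limsup (Eventually.of_forall fun n => ?_) (hlow x) (hup y)
    exact sub_le_sub_right (hit n hxy) _
  · have : s (x + 1) = fun n => s x n + 1 := by
      funext n
      have := h_ind n x 1
      push_cast at this
      simp only [s, this]
      ring
    simp only [this]
    exact limsup_add_const atTop (s x) 1 (hup x) (hlow x)
  · have : s (F x) = fun n => s x (n + 1) + τ := by
      funext n
      simp only [s, Function.iterate_succ_apply]
      push_cast
      ring
    simp only [this]
    rw [limsup_add_const atTop (fun n => s x (n + 1)) τ
      (isBoundedUnder_of ⟨_, fun n => (hbdd x (n + 1)).2⟩)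
      (IsBoundedUnder.isCoboundedUnder_le (isBoundedUnder_of ⟨_, fun n => (hbdd x (n + 1)).1⟩)),
      limsup_nat_add (s x) 1]

section PowerLaw

variable {ψ : ℝ → ℝ} {ℓ : ℝ}

theorem hasDerivAt_comp_rpow (hψ : Differentiable ℝ ψ) (hℓ : 1 ≤ ℓ) (t : ℝ) :
    HasDerivAt (fun t => ψ (t ^ ℓ)) (deriv ψ (t ^ ℓ) * (ℓ * t ^ (ℓ - 1))) t :=
  (hψ _).hasDerivAt.comp t (Real.hasDerivAt_rpow_const (Or.inr hℓ))

theorem contDiffAt_log_deriv_comp_rpow (hψ : ContDiff ℝ (⊤ : ℕ∞) ψ) (hψ' : 0 < deriv ψ 0)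
    (hℓ : 1 ≤ ℓ) : ContDiffAt ℝ 1 (fun t => Real.log (deriv ψ (t ^ ℓ))) 0 := by
  have h1 : ContDiff ℝ 1 (deriv ψ) :=
    (contDiff_infty_iff_deriv.1 hψ).2.of_le (by exact_mod_cast le_top)
  have h2 : ContDiffAt ℝ 1 (fun t : ℝ => t ^ ℓ) 0 := by
    have := Real.contDiffAt_rpow_const_of_le (x := 0) (p := ℓ) (n := 1) (by simpa using hℓ)
    simpa using this
  refine ContDiffAt.log (h1.contDiffAt.comp 0 h2) ?_
  simpa [Real.zero_rpow (by linarith : ℓ ≠ 0)] using hψ'.ne'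

theorem eventually_mul_rpow_le_comp_rpow (hψ : Differentiable ℝ ψ) (hψ0 : ψ 0 = 0)
    (hψ' : 0 < deriv ψ 0) (hℓ : 1 ≤ ℓ) :
    ∀ᶠ t in nhdsWithin (0 : ℝ) (Set.Ici 0), deriv ψ 0 / 2 * t ^ ℓ ≤ ψ (t ^ ℓ) := by
  have h1 : ∀ᶠ s in nhds (0 : ℝ), |ψ s - deriv ψ 0 * s| ≤ deriv ψ 0 / 2 * |s| := by
    have := (hasDerivAt_iff_isLittleO.1 (hψ 0).hasDerivAt).def (half_pos hψ')
    filter_upwards [this] with s hs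
    simpa [hψ0, mul_comm] using hs
  have h2 : Tendsto (fun t : ℝ => t ^ ℓ) (nhdsWithin 0 (Set.Ici 0)) (nhds 0) := by
    have := (Real.continuous_rpow_const (by linarith : 0 ≤ ℓ)).tendsto 0
    rw [Real.zero_rpow (by linarith)] at this
    exact this.mono_left nhdsWithin_le_nhds
  filter_upwards [h2.eventually h1, self_mem_nhdsWithin] with t ht ht0
  rw [abs_of_nonneg (Real.rpow_nonneg ht0 ℓ)] at ht
  have := (abs_le.1 ht).1
  linarith

/-- A monotone function which grows like `ψ (t ^ ℓ)` near `0` is bounded below by a multiple of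
`t ^ ℓ` on `[0, 1]`. -/
theorem exists_mul_rpow_le (hψ : Differentiable ℝ ψ) (hψ0 : ψ 0 = 0) (hψ' : 0 < deriv ψ 0)
    (hℓ : 1 ≤ ℓ) {G : ℝ → ℝ} (hG : MonotoneOn G (Set.Icc 0 1)) {ε : ℝ} (hε : 0 < ε)
    (hGψ : ∀ t ∈ Set.Ico 0 ε, G t = ψ (t ^ ℓ)) :
    ∃ κ > 0, ∀ t ∈ Set.Icc (0 : ℝ) 1, κ * t ^ ℓ ≤ G t := by
  obtain ⟨η, hη, hη'⟩ := Metric.mem_nhdsWithin_iff.1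
    (eventually_mul_rpow_le_comp_rpow hψ hψ0 hψ' hℓ)
  let r := min (min (η / 2) (ε / 2)) 1
  have hr : 0 < r := by positivity
  have hr1 : r ≤ 1 := min_le_right _ _
  have hrη : r < η := ((min_le_left _ _).trans (min_le_left _ _)).trans_lt (half_lt_self hη)
  have hrε : r < ε := ((min_le_left _ _).trans (min_le_right _ _)).trans_lt (half_lt_self hε)
  have hsmall : ∀ t, 0 ≤ t → t ≤ r → deriv ψ 0 / 2 * t ^ ℓ ≤ G t := fun t ht0 htr => by
    rw [hGψ t ⟨ht0, by linarith⟩]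
    refine hη' ⟨?_, ht0⟩
    rw [Metric.mem_ball, Real.dist_eq, sub_zero, abs_of_nonneg ht0]
    linarith
  have hrℓ : 0 < r ^ ℓ := Real.rpow_pos_of_pos hr ℓ
  have hrℓ1 : r ^ ℓ ≤ 1 := Real.rpow_le_one hr.le hr1 (by linarith)
  refine ⟨deriv ψ 0 / 2 * r ^ ℓ, by positivity, fun t ht => ?_⟩
  have htℓ : 0 ≤ t ^ ℓ := Real.rpow_nonneg ht.1 ℓ
  have htℓ1 : t ^ ℓ ≤ 1 := Real.rpow_le_one ht.1 ht.2 (by linarith)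
  rcases le_total t r with h | h
  · refine le_trans ?_ (hsmall t ht.1 h)
    have := mul_le_mul_of_nonneg_left hrℓ1 (mul_nonneg (half_pos hψ').le htℓ)
    linarith
  · have h1 := hG ⟨hr.le, hr1⟩ ht h
    have h2 := mul_le_mul_of_nonneg_left htℓ1 (mul_nonneg (half_pos hψ').le hrℓ.le)
    linarith [hsmall r hr.le le_rfl]

end PowerLaw

namespace CherryMap

variable {ℓ : ℝ} (X : CherryMap ℓ)

theorem F_add_int (x : ℝ) (k : ℤ) : X.F (x + k) = X.F x + k :=
  (⟨⟨X.F, X.mono⟩, X.degree_one⟩ : CircleDeg1Lift).map_add_int x k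

theorem F_right (x : ℝ) (hx : x ∈ Set.Ico X.b (X.b + X.ε)) :
    X.F x = X.F X.b + X.ψb ((x - X.b) ^ ℓ) := by
  rw [← X.local_b (x - X.b) ⟨by linarith [hx.1], by linarith [hx.2]⟩, add_sub_cancel]

theorem F_left (x : ℝ) (hx : x ∈ Set.Ioc (X.a - X.ε) X.a) :
    X.F x = X.F X.a - X.ψa ((X.a - x) ^ ℓ) := by
  rw [← X.local_a (X.a - x) ⟨by linarith [hx.2], by linarith [hx.1]⟩, sub_sub_cancel]

theorem hasDerivAt_right (hℓ : 1 ≤ ℓ) (x : ℝ) :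
    HasDerivAt (fun x => X.F X.b + X.ψb ((x - X.b) ^ ℓ))
      (deriv X.ψb ((x - X.b) ^ ℓ) * (ℓ * (x - X.b) ^ (ℓ - 1))) x := by
  have h1 := hasDerivAt_comp_rpow (X.ψb_smooth.differentiable (by simp)) hℓ (x - X.b)
  simpa using (h1.comp_sub_const x X.b).const_add (X.F X.b)

theorem hasDerivAt_left (hℓ : 1 ≤ ℓ) (x : ℝ) :
    HasDerivAt (fun x => X.F X.a - X.ψa ((X.a - x) ^ ℓ))
      (deriv X.ψa ((X.a - x) ^ ℓ) * (ℓ * (X.a - x) ^ (ℓ - 1))) x := by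
  have h1 := hasDerivAt_comp_rpow (X.ψa_smooth.differentiable (by simp)) hℓ (X.a - x)
  simpa using (h1.comp_const_sub X.a x).const_sub (X.F X.a)

theorem hasDerivAt_zero (hℓ : 1 < ℓ) {x : ℝ} (hx : x ∈ Set.Icc X.a X.b) : HasDerivAt X.F 0 x := by
  have hab := X.hab
  have hε := X.εpos
  have h0 : (0 : ℝ) ^ (ℓ - 1) = 0 := Real.zero_rpow (by linarith)
  have hL : HasDerivWithinAt X.F 0 (Set.Iic x) x := by
    rcases eq_or_lt_of_le hx.1 with rfl | hlt
    · have h1 := X.hasDerivAt_left hℓ.le X.a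
      rw [sub_self, h0, mul_zero, mul_zero] at h1
      refine h1.hasDerivWithinAt.congr_of_eventuallyEq_of_mem ?_ (Set.mem_Iic.2 le_rfl)
      filter_upwards [Ioc_mem_nhdsLE (by linarith : X.a - X.ε < X.a)] with y hy
        using X.F_left y hy
    · refine (hasDerivWithinAt_const x (Set.Iic x) (X.F X.a)).congr_of_eventuallyEq_of_mem ?_
        (Set.mem_Iic.2 le_rfl)
      filter_upwards [Ioc_mem_nhdsLE hlt] with y hy
        using X.flat y ⟨hy.1.le, hy.2.trans hx.2⟩
  have hR : HasDerivWithinAt X.F 0 (Set.Ici x) x := by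
    rcases eq_or_lt_of_le hx.2 with rfl | hlt
    · have h1 := X.hasDerivAt_right hℓ.le X.b
      rw [sub_self, h0, mul_zero, mul_zero] at h1
      refine h1.hasDerivWithinAt.congr_of_eventuallyEq_of_mem ?_ (Set.mem_Ici.2 le_rfl)
      filter_upwards [Ico_mem_nhdsGE (by linarith : X.b < X.b + X.ε)] with y hy
        using X.F_right y hy
    · refine (hasDerivWithinAt_const x (Set.Ici x) (X.F X.a)).congr_of_eventuallyEq_of_mem ?_
        (Set.mem_Ici.2 le_rfl)
      filter_upwards [Ico_mem_nhdsGE hlt] with y hy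
        using X.flat y ⟨hx.1.trans hy.1, hy.2.le⟩
  have := hL.union hR
  rwa [Set.Iic_union_Ici, hasDerivWithinAt_univ] at this

theorem deriv_add_int (x : ℝ) (k : ℤ) : deriv X.F (x + k) = deriv X.F x := by
  rw [← deriv_comp_add_const]
  simp only [X.F_add_int]
  exact deriv_add_const _

theorem deriv_reduceMod (x : ℝ) : deriv X.F (reduceMod X.a x) = deriv X.F x := by
  rw [reduceMod_eq, X.deriv_add_int]

theorem contDiffAt (x : ℝ) (hx : x ∈ Set.Ioo X.b (X.a + 1)) :
    ContDiffAt ℝ (⊤ : ℕ∞) X.F x :=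
  X.smooth.contDiffAt (isOpen_Ioo.mem_nhds hx)

theorem differentiable (hℓ : 1 < ℓ) : Differentiable ℝ X.F := by
  intro x
  have hr := reduceMod_mem X.a x
  have h1 : DifferentiableAt ℝ X.F (reduceMod X.a x) := by
    rcases le_or_gt (reduceMod X.a x) X.b with h | h
    · exact (X.hasDerivAt_zero hℓ ⟨hr.1, h⟩).differentiableAt
    · exact (X.contDiffAt _ ⟨h, hr.2⟩).differentiableAt (by simp)
  rw [reduceMod_eq] at h1
  have h2 : DifferentiableAt ℝ (fun y => X.F (y + ((-⌊x - X.a⌋ : ℤ) : ℝ))) x :=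
    DifferentiableAt.comp x h1 (by fun_prop)
  simp only [X.F_add_int] at h2
  simpa using h2.sub_const (((-⌊x - X.a⌋ : ℤ) : ℝ))

theorem reduceMod_mem_Ioo (hℓ : 1 < ℓ) {x : ℝ} (hx : deriv X.F x ≠ 0) :
    reduceMod X.a x ∈ Set.Ioo X.b (X.a + 1) := by
  have hr := reduceMod_mem X.a x
  refine ⟨?_, hr.2⟩
  by_contra! h
  exact hx (by rw [← X.deriv_reduceMod, (X.hasDerivAt_zero hℓ ⟨hr.1, h⟩).deriv])

theorem exists_mul_rpow_le_right (hℓ : 1 < ℓ) :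
    ∃ κ > 0, ∀ t ∈ Set.Icc (0 : ℝ) 1, κ * t ^ ℓ ≤ X.F (X.b + t) - X.F X.b :=
  _root_.exists_mul_rpow_le (X.ψb_smooth.differentiable (by simp)) X.ψb_zero X.ψb_deriv_pos hℓ.le
    (fun s _ t _ hst => sub_le_sub_right (X.mono (by linarith)) _) X.εpos
    fun t ht => by rw [X.local_b t ht, add_sub_cancel_left]

theorem exists_mul_rpow_le_left (hℓ : 1 < ℓ) :
    ∃ κ > 0, ∀ t ∈ Set.Icc (0 : ℝ) 1, κ * t ^ ℓ ≤ X.F X.a - X.F (X.a - t) :=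
  _root_.exists_mul_rpow_le (X.ψa_smooth.differentiable (by simp)) X.ψa_zero X.ψa_deriv_pos hℓ.le
    (fun s _ t _ hst => sub_le_sub_left (X.mono (by linarith)) _) X.εpos
    fun t ht => by rw [X.local_a t ht, sub_sub_cancel]

/-- At both endpoints of the flat interval, `F` grows at least like a multiple of `t ^ ℓ`. -/
theorem exists_mul_rpow_le (hℓ : 1 < ℓ) : ∃ κ > 0,
    (∀ t ∈ Set.Icc (0 : ℝ) 1, κ * t ^ ℓ ≤ X.F (X.b + t) - X.F X.b) ∧
      ∀ t ∈ Set.Icc (0 : ℝ) 1, κ * t ^ ℓ ≤ X.F X.a - X.F (X.a - t) := by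
  obtain ⟨κ₁, hκ₁, hr⟩ := X.exists_mul_rpow_le_right hℓ
  obtain ⟨κ₂, hκ₂, hl⟩ := X.exists_mul_rpow_le_left hℓ
  refine ⟨min κ₁ κ₂, lt_min hκ₁ hκ₂, fun t ht => ?_, fun t ht => ?_⟩
  · exact (mul_le_mul_of_nonneg_right (min_le_left _ _) (Real.rpow_nonneg ht.1 _)).trans (hr t ht)
  · exact (mul_le_mul_of_nonneg_right (min_le_right _ _) (Real.rpow_nonneg ht.1 _)).trans (hl t ht)

/-- Off the flat interval, `log F'` is the sum of a Lipschitz function and `ℓ - 1` times the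
logarithms of the distances to the endpoints. -/
theorem exists_lipschitz_log_deriv (hℓ : 1 < ℓ) :
    ∃ (L : NNReal) (g : ℝ → ℝ), LipschitzWith L g ∧ ∀ x ∈ Set.Ioo X.b (X.a + 1),
      Real.log (deriv X.F x) =
        g x + (ℓ - 1) * (Real.log (x - X.b) + Real.log (X.a + 1 - x)) := by
  have hba := X.hba
  have hε := X.εpos
  let g₀ : ℝ → ℝ := fun x =>
    Real.log (deriv X.F x) - (ℓ - 1) * (Real.log (x - X.b) + Real.log (X.a + 1 - x))
  let gb : ℝ → ℝ := fun x =>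
    Real.log (deriv X.ψb ((x - X.b) ^ ℓ)) + Real.log ℓ - (ℓ - 1) * Real.log (X.a + 1 - x)
  let ga : ℝ → ℝ := fun x =>
    Real.log (deriv X.ψa ((X.a + 1 - x) ^ ℓ)) + Real.log ℓ - (ℓ - 1) * Real.log (x - X.b)
  let g : ℝ → ℝ := fun x => if x = X.b then gb x else if x = X.a + 1 then ga x else g₀ x
  have hg₀ : ∀ x, x ∈ Set.Ioo X.b (X.a + 1) → g x = g₀ x := fun x hx => by
    simp only [g, if_neg hx.1.ne', if_neg hx.2.ne]
  have hgb : ∀ x ∈ Set.Ioo X.b (X.a + 1), x < X.b + X.ε → g₀ x = gb x := fun x hx hxε => by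
    have h1 : 0 < x - X.b := by linarith [hx.1]
    have h2 : deriv X.F x = deriv X.ψb ((x - X.b) ^ ℓ) * (ℓ * (x - X.b) ^ (ℓ - 1)) := by
      refine ((X.hasDerivAt_right hℓ.le x).congr_of_eventuallyEq ?_).deriv
      filter_upwards [Ioo_mem_nhds hx.1 hxε] with y hy using X.F_right y ⟨hy.1.le, hy.2⟩
    have h3 : 0 < ℓ * (x - X.b) ^ (ℓ - 1) := by positivity
    have h4 : 0 < deriv X.ψb ((x - X.b) ^ ℓ) := by
      have := X.deriv_pos x hx
      rw [h2] at this
      exact pos_of_mul_pos_left this h3.le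
    simp only [g₀, gb]
    rw [h2, Real.log_mul h4.ne' h3.ne', Real.log_mul (by linarith) (by positivity),
      Real.log_rpow h1]
    ring
  have hga : ∀ x ∈ Set.Ioo X.b (X.a + 1), X.a + 1 - X.ε < x → g₀ x = ga x := fun x hx hxε => by
    have h1 : 0 < X.a + 1 - x := by linarith [hx.2]
    have h2 : deriv X.F x = deriv X.ψa ((X.a + 1 - x) ^ ℓ) * (ℓ * (X.a + 1 - x) ^ (ℓ - 1)) := by
      have h3 : deriv X.F (x - 1) = deriv X.F x := by
        have := X.deriv_add_int x (-1)
        push_cast at this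
        rwa [← sub_eq_add_neg] at this
      have h4 : X.a - (x - 1) = X.a + 1 - x := by ring
      rw [← h3, ← h4]
      refine ((X.hasDerivAt_left hℓ.le (x - 1)).congr_of_eventuallyEq ?_).deriv
      filter_upwards [Ioo_mem_nhds (by linarith : X.a - X.ε < x - 1)
        (by linarith [hx.2] : x - 1 < X.a)] with y hy using X.F_left y ⟨hy.1, hy.2.le⟩
    have h3 : 0 < ℓ * (X.a + 1 - x) ^ (ℓ - 1) := by positivity
    have h4 : 0 < deriv X.ψa ((X.a + 1 - x) ^ ℓ) := by
      have := X.deriv_pos x hx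
      rw [h2] at this
      exact pos_of_mul_pos_left this h3.le
    simp only [g₀, ga]
    rw [h2, Real.log_mul h4.ne' h3.ne', Real.log_mul (by linarith) (by positivity),
      Real.log_rpow h1]
    ring
  have hsmooth : ContDiffOn ℝ 1 g (Set.Icc X.b (X.a + 1)) := by
    intro x hx
    rcases eq_or_lt_of_le hx.1 with rfl | hxb
    · have h1 : ContDiffAt ℝ 1 gb X.b := by
        have h2 := contDiffAt_log_deriv_comp_rpow X.ψb_smooth X.ψb_deriv_pos hℓ.le
        have h3 : ContDiffAt ℝ 1 (fun x => Real.log (deriv X.ψb ((x - X.b) ^ ℓ))) X.b :=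
          ContDiffAt.comp X.b (g := fun t => Real.log (deriv X.ψb (t ^ ℓ)))
            (f := fun x => x - X.b) (by simpa using h2) (by fun_prop)
        refine (h3.add contDiffAt_const).sub (contDiffAt_const.mul (ContDiffAt.log ?_ ?_))
        · fun_prop
        · linarith
      refine h1.contDiffWithinAt.congr_of_eventuallyEq ?_ (by simp [g])
      have hlt : X.b < min (X.b + X.ε) (X.a + 1) := lt_min (by linarith) hba
      filter_upwards [nhdsWithin_mono _ Set.Icc_subset_Ici_self (Ico_mem_nhdsGE hlt)] with y hy
      rcases eq_or_lt_of_le hy.1 with rfl | hyb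
      · simp [g]
      · have hyIoo : y ∈ Set.Ioo X.b (X.a + 1) := ⟨hyb, hy.2.trans_le (min_le_right _ _)⟩
        rw [hg₀ y hyIoo, hgb y hyIoo (hy.2.trans_le (min_le_left _ _))]
    rcases eq_or_lt_of_le hx.2 with rfl | hxa
    · have h1 : ContDiffAt ℝ 1 ga (X.a + 1) := by
        have h2 := contDiffAt_log_deriv_comp_rpow X.ψa_smooth X.ψa_deriv_pos hℓ.le
        have h3 : ContDiffAt ℝ 1 (fun x => Real.log (deriv X.ψa ((X.a + 1 - x) ^ ℓ))) (X.a + 1) :=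
          ContDiffAt.comp (X.a + 1) (g := fun t => Real.log (deriv X.ψa (t ^ ℓ)))
            (f := fun x => X.a + 1 - x) (by simpa using h2) (by fun_prop)
        refine (h3.add contDiffAt_const).sub (contDiffAt_const.mul (ContDiffAt.log ?_ ?_))
        · fun_prop
        · linarith
      refine h1.contDiffWithinAt.congr_of_eventuallyEq ?_ (by simp [g, hba.ne'])
      have hlt : max (X.a + 1 - X.ε) X.b < X.a + 1 := max_lt (by linarith) hba
      filter_upwards [nhdsWithin_mono _ Set.Icc_subset_Iic_self (Ioc_mem_nhdsLE hlt)] with y hy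
      rcases eq_or_lt_of_le hy.2 with rfl | hya
      · simp [g, hba.ne']
      · have hyIoo : y ∈ Set.Ioo X.b (X.a + 1) := ⟨(le_max_right _ _).trans_lt hy.1, hya⟩
        rw [hg₀ y hyIoo, hga y hyIoo ((le_max_left _ _).trans_lt hy.1)]
    · have hxIoo : x ∈ Set.Ioo X.b (X.a + 1) := ⟨hxb, hxa⟩
      have h1 : ContDiffAt ℝ 1 (deriv X.F) x := by
        have h2 : ContDiffOn ℝ (⊤ : ℕ∞) (deriv X.F) (Set.Ioo X.b (X.a + 1)) :=
          ((contDiffOn_infty_iff_deriv_of_isOpen isOpen_Ioo).1 X.smooth).2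
        exact (h2.contDiffAt (isOpen_Ioo.mem_nhds hxIoo)).of_le (by exact_mod_cast le_top)
      have h2 : ContDiffAt ℝ 1 g₀ x := by
        refine (h1.log (X.deriv_pos x hxIoo).ne').sub (contDiffAt_const.mul
          (ContDiffAt.add (ContDiffAt.log ?_ ?_) (ContDiffAt.log ?_ ?_)))
        · fun_prop
        · linarith
        · fun_prop
        · linarith
      refine (h2.congr_of_eventuallyEq ?_).contDiffWithinAt
      filter_upwards [isOpen_Ioo.mem_nhds hxIoo] with y hy using hg₀ y hy
  obtain ⟨L, hL⟩ := hsmooth.exists_lipschitzOnWith one_ne_zero (convex_Icc _ _) isCompact_Icc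
  obtain ⟨g', hg', heq⟩ := hL.extend_real
  refine ⟨L, g', hg', fun x hx => ?_⟩
  rw [← heq ⟨hx.1.le, hx.2.le⟩, hg₀ x hx]
  simp only [g₀]
  ring

end CherryMap

namespace CherryMap

variable {ℓ : ℝ} (X : CherryMap ℓ) (q : ℕ → ℕ) (P : ℕ → ℤ)

/-- The closest returns of the left endpoint of the flat interval to the flat interval, in the
lift. -/
def closeReturn (n : ℕ) : ℝ := X.F^[q n] X.a - P n

/-- The distance from the `n`-th closest return to the flat interval. -/
def returnDist (n : ℕ) : ℝ := max (X.closeReturn q P n - X.b) (X.a - X.closeReturn q P n)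

/-- The smaller of the distances of two consecutive closest returns. -/
def scale (n : ℕ) : ℝ := min (X.returnDist q P n) (X.returnDist q P (n + 1))

variable {q P} {β : ℕ → ℝ} {h : ℝ → ℝ} {τ : ℝ}

theorem semiconj_b (H : IsRotationSemiconj X.F h τ) (ha : h X.a = 0) : h X.b = 0 := by
  have h1 := H.map X.a
  have h2 := H.map X.b
  rw [X.flat X.b ⟨X.hab.le, le_rfl⟩] at h2
  linarith

theorem exists_even_scale_le (hc : IsConvergents τ q P β) (n : ℕ) : ∃ m,
    Even m ∧ β m ≤ β n ∧ X.scale q P n ≤ X.returnDist q P m := by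
  rcases n.even_or_odd with hn | hn
  · exact ⟨n, hn, le_rfl, min_le_left _ _⟩
  · exact ⟨n + 1, hn.add_one, (hc.β_succ_lt n).le, min_le_right _ _⟩

theorem exists_odd_scale_le (hc : IsConvergents τ q P β) (n : ℕ) : ∃ m,
    Odd m ∧ β m ≤ β n ∧ X.scale q P n ≤ X.returnDist q P m := by
  rcases n.even_or_odd with hn | hn
  · exact ⟨n + 1, hn.add_one, (hc.β_succ_lt n).le, min_le_right _ _⟩
  · exact ⟨n, hn, le_rfl, min_le_left _ _⟩

section Returns

variable (H : IsRotationSemiconj X.F h τ) (hc : IsConvergents τ q P β) (ha : h X.a = 0)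

include H hc ha

theorem semiconj_closeReturn (n : ℕ) : h (X.closeReturn q P n) = (-1) ^ n * β n := by
  have h1 := H.add_int (X.F^[q n] X.a) (-P n)
  rw [H.iterate, ha] at h1
  rw [← hc.error, closeReturn]
  push_cast at h1
  rw [sub_eq_add_neg, h1]
  ring

theorem closeReturn_mem_of_even {n : ℕ} (hn : Even n) :
    X.closeReturn q P n ∈ Set.Ioo X.b (X.a + 1) := by
  have h1 := X.semiconj_closeReturn H hc ha n
  rw [hn.neg_one_pow, one_mul] at h1
  refine ⟨H.lt_of_lt ?_, H.lt_of_lt ?_⟩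
  · rw [X.semiconj_b H ha, h1]
    exact hc.β_pos n
  · rw [H.add_one, ha, h1]
    linarith [hc.β_lt_one n]

theorem closeReturn_mem_of_odd {n : ℕ} (hn : Odd n) :
    X.closeReturn q P n ∈ Set.Ioo (X.b - 1) X.a := by
  have h1 := X.semiconj_closeReturn H hc ha n
  rw [hn.neg_one_pow, neg_one_mul] at h1
  refine ⟨H.lt_of_lt ?_, H.lt_of_lt ?_⟩
  · have h2 := H.add_one (X.b - 1)
    rw [sub_add_cancel, X.semiconj_b H ha] at h2
    rw [h1]
    linarith [hc.β_lt_one n]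
  · rw [ha, h1]
    linarith [hc.β_pos n]

theorem returnDist_of_even {n : ℕ} (hn : Even n) :
    X.returnDist q P n = X.closeReturn q P n - X.b :=
  max_eq_left (by linarith [(X.closeReturn_mem_of_even H hc ha hn).1, X.hab])

theorem returnDist_of_odd {n : ℕ} (hn : Odd n) :
    X.returnDist q P n = X.a - X.closeReturn q P n :=
  max_eq_right (by linarith [(X.closeReturn_mem_of_odd H hc ha hn).2, X.hab])

theorem returnDist_mem (n : ℕ) : X.returnDist q P n ∈ Set.Ioc (0 : ℝ) 1 := by
  have hab := X.hab
  rcases n.even_or_odd with hn | hn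
  · have := X.closeReturn_mem_of_even H hc ha hn
    rw [X.returnDist_of_even H hc ha hn]
    exact ⟨by linarith [this.1], by linarith [this.2]⟩
  · have := X.closeReturn_mem_of_odd H hc ha hn
    rw [X.returnDist_of_odd H hc ha hn]
    exact ⟨by linarith [this.2], by linarith [this.1]⟩

theorem returnDist_add_two_le (n : ℕ) : X.returnDist q P (n + 2) ≤ X.returnDist q P n := by
  have h0 := X.semiconj_closeReturn H hc ha n
  have h2 := X.semiconj_closeReturn H hc ha (n + 2)
  have hβ : β (n + 2) < β n := (hc.β_succ_lt (n + 1)).trans (hc.β_succ_lt n)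
  rcases n.even_or_odd with hn | hn
  · have hn2 : Even (n + 2) := hn.add even_two
    rw [hn.neg_one_pow, one_mul] at h0
    rw [hn2.neg_one_pow, one_mul] at h2
    rw [X.returnDist_of_even H hc ha hn, X.returnDist_of_even H hc ha hn2]
    have := H.lt_of_lt (h0 ▸ h2 ▸ hβ : h (X.closeReturn q P (n + 2)) < h (X.closeReturn q P n))
    linarith
  · have hn2 : Odd (n + 2) := hn.add_even even_two
    rw [hn.neg_one_pow, neg_one_mul] at h0
    rw [hn2.neg_one_pow, neg_one_mul] at h2
    rw [X.returnDist_of_odd H hc ha hn, X.returnDist_of_odd H hc ha hn2]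
    have := H.lt_of_lt (by linarith : h (X.closeReturn q P n) < h (X.closeReturn q P (n + 2)))
    linarith

theorem scale_mem (n : ℕ) : X.scale q P n ∈ Set.Ioc (0 : ℝ) 1 :=
  ⟨lt_min (X.returnDist_mem H hc ha n).1 (X.returnDist_mem H hc ha (n + 1)).1,
    (min_le_left _ _).trans (X.returnDist_mem H hc ha n).2⟩

theorem scale_anti : Antitone (X.scale q P) :=
  antitone_nat_of_succ_le fun n => le_min
    ((min_le_right _ _).trans (X.returnDist_add_two_le H hc ha n)) (min_le_left _ _)

theorem add_scale_le {n : ℕ} {x : ℝ} (hx : β n < h x) : X.b + X.scale q P n ≤ x := by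
  obtain ⟨m, hm, hβ, hs⟩ := X.exists_even_scale_le hc n
  have h1 := X.semiconj_closeReturn H hc ha m
  rw [hm.neg_one_pow, one_mul] at h1
  rw [X.returnDist_of_even H hc ha hm] at hs
  linarith [H.lt_of_lt (by linarith : h (X.closeReturn q P m) < h x)]

theorem le_sub_scale {n : ℕ} {x : ℝ} (hx : h x < -β n) : x ≤ X.a - X.scale q P n := by
  obtain ⟨m, hm, hβ, hs⟩ := X.exists_odd_scale_le hc n
  have h1 := X.semiconj_closeReturn H hc ha m
  rw [hm.neg_one_pow, neg_one_mul] at h1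
  rw [X.returnDist_of_odd H hc ha hm] at hs
  linarith [H.lt_of_lt (by linarith : h x < h (X.closeReturn q P m))]

theorem lt_scale_or (n : ℕ) :
    (∀ x, 0 < h x → h x < β (n + 1) → x - X.b < X.scale q P n) ∨
      ∀ x, 1 - β (n + 1) < h x → h x < 1 → X.a + 1 - x < X.scale q P n := by
  obtain ⟨m, hβ, hs⟩ : ∃ m, β (n + 1) ≤ β m ∧ X.scale q P n = X.returnDist q P m := by
    rcases min_choice (X.returnDist q P n) (X.returnDist q P (n + 1)) with h1 | h1
    · exact ⟨n, (hc.β_succ_lt n).le, h1⟩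
    · exact ⟨n + 1, le_rfl, h1⟩
  have h1 := X.semiconj_closeReturn H hc ha m
  rcases m.even_or_odd with hm | hm
  · left
    intro x _ hx
    rw [hm.neg_one_pow, one_mul] at h1
    rw [hs, X.returnDist_of_even H hc ha hm]
    linarith [H.lt_of_lt (by linarith : h x < h (X.closeReturn q P m))]
  · right
    intro x hx _
    rw [hm.neg_one_pow, neg_one_mul] at h1
    rw [hs, X.returnDist_of_odd H hc ha hm]
    have h2 := H.add_one (X.closeReturn q P m)
    linarith [H.lt_of_lt (by linarith : h (X.closeReturn q P m + 1) < h x)]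

/-- Any orbit segment of length `q n` visits the neighbourhood of the flat interval of size
`scale k` at least `q n * β (k + 1) - 6` times. -/
theorem le_card_visits (y : ℝ) (k n : ℕ) :
    q n * β (k + 1) - 6 ≤ ({i ∈ Finset.range (q n) |
      min (reduceMod X.a (X.F^[i] y) - X.b) (X.a + 1 - reduceMod X.a (X.F^[i] y))
        < X.scale q P k}.card : ℝ) := by
  set x : ℕ → ℝ := fun i => reduceMod X.a (X.F^[i] y) with hx
  have hβ := hc.β_pos (k + 1)
  have hβ1 := hc.β_lt_one (k + 1)
  have hmem : ∀ i, h (x i) ∈ Set.Icc (0 : ℝ) 1 := fun i => H.reduceMod_mem_Icc ha _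
  obtain ⟨e, u, v, huv, huv', hS⟩ : ∃ e u v : ℝ, u ≤ v ∧ v - u = 1 - β (k + 1) ∧
      ∀ i, ¬ min (x i - X.b) (X.a + 1 - x i) < X.scale q P k →
        h (x i) ∈ Set.Icc e e ∨ h (x i) ∈ Set.Icc u v := by
    rcases X.lt_scale_or H hc ha k with hk | hk
    · refine ⟨0, β (k + 1), 1, hβ1.le, rfl, fun i hi => ?_⟩
      have h1 : ¬ (0 < h (x i) ∧ h (x i) < β (k + 1)) := fun h1 =>
        hi ((min_le_left _ _).trans_lt (hk _ h1.1 h1.2))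
      by_cases h0 : h (x i) ≤ 0
      · exact Or.inl ⟨(hmem i).1, h0⟩
      · exact Or.inr ⟨by_contra fun h2 => h1 ⟨not_le.1 h0, not_le.1 h2⟩, (hmem i).2⟩
    · refine ⟨1, 0, 1 - β (k + 1), by linarith, by ring, fun i hi => ?_⟩
      have h1 : ¬ (1 - β (k + 1) < h (x i) ∧ h (x i) < 1) := fun h1 =>
        hi ((min_le_right _ _).trans_lt (hk _ h1.1 h1.2))
      by_cases h0 : 1 ≤ h (x i)
      · exact Or.inl ⟨h0, (hmem i).2⟩
      · exact Or.inr ⟨(hmem i).1, by_contra fun h2 => h1 ⟨not_le.1 h2, not_le.1 h0⟩⟩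
  have hcount : ∀ s t : ℝ, s ≤ t →
      (({i ∈ Finset.range (q n) | h (x i) ∈ Set.Icc s t}.card : ℕ) : ℝ) ≤ q n * (t - s) + 3 := by
    intro s t hst
    refine card_rotation_mem_Icc_le (hc.q_pos n) (hc.isCoprime n) (hc.abs_error_mul_le n) (h y) hst
      fun i hi => ?_
    rw [Finset.mem_filter, Finset.mem_range] at hi
    obtain ⟨k, hk⟩ := H.reduceMod_iterate X.a y i
    exact ⟨hi.1, k, hk ▸ hi.2⟩
  have h1 := hcount e e le_rfl
  have h2 := hcount u v huv
  have h3 : {i ∈ Finset.range (q n) | ¬ min (x i - X.b) (X.a + 1 - x i) < X.scale q P k}.card ≤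
      {i ∈ Finset.range (q n) | h (x i) ∈ Set.Icc e e}.card +
        {i ∈ Finset.range (q n) | h (x i) ∈ Set.Icc u v}.card := by
    refine (Finset.card_le_card fun i hi => ?_).trans (Finset.card_union_le _ _)
    rw [Finset.mem_filter] at hi
    rw [Finset.mem_union, Finset.mem_filter, Finset.mem_filter]
    exact (hS i hi.2).imp (⟨hi.1, ·⟩) (⟨hi.1, ·⟩)
  have h4 := Finset.card_filter_add_card_filter_not (s := Finset.range (q n))
    (fun i => min (x i - X.b) (X.a + 1 - x i) < X.scale q P k)
  rw [Finset.card_range] at h4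
  have h5 : (q n : ℝ) = _ := congrArg (Nat.cast : ℕ → ℝ) h4.symm
  have h3' : (_ : ℝ) ≤ _ := Nat.cast_le.2 h3
  push_cast at h5 h3'
  rw [huv'] at h2
  linarith

end Returns

theorem hasDerivAt_iterate (hℓ : 1 < ℓ) (m : ℕ) (x : ℝ) :
    HasDerivAt X.F^[m] (∏ i ∈ Finset.range m, deriv X.F (X.F^[i] x)) x := by
  induction m with
  | zero => simpa using hasDerivAt_id x
  | succ m ih =>
    rw [Function.iterate_succ', Finset.prod_range_succ, mul_comm]
    exact (X.differentiable hℓ _).hasDerivAt.comp x ih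

theorem exists_prod_deriv_eq_slope (hℓ : 1 < ℓ) (m : ℕ) {u v : ℝ} (huv : u < v) :
    ∃ y ∈ Set.Ioo u v, ∏ i ∈ Finset.range m, deriv X.F (X.F^[i] y) =
      (X.F^[m] v - X.F^[m] u) / (v - u) :=
  exists_hasDerivAt_eq_slope X.F^[m] _ huv
    (fun x _ => (X.hasDerivAt_iterate hℓ m x).continuousAt.continuousWithinAt)
    fun x _ => X.hasDerivAt_iterate hℓ m x

theorem iterate_sub_le_one (m : ℕ) {u v : ℝ} (huv : v ≤ u + 1) : X.F^[m] v - X.F^[m] u ≤ 1 := by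
  have h1 := (X.mono.iterate m) huv
  have h2 : X.F^[m] (u + 1) = X.F^[m] u + 1 := by
    have h3 : Function.Semiconj (· + 1) X.F X.F := fun x => (X.degree_one x).symm
    exact ((h3.iterate_right m) u).symm
  linarith

section Distortion

variable (H : IsRotationSemiconj X.F h τ) (hc : IsConvergents τ q P β) (ha : h X.a = 0)

include H hc ha

theorem add_mul_scale_le {κ : ℝ} (hκ : 0 ≤ κ) (hℓ : 0 ≤ ℓ)
    (hr : ∀ t ∈ Set.Icc (0 : ℝ) 1, κ * t ^ ℓ ≤ X.F (X.b + t) - X.F X.b) {n : ℕ} {y : ℝ}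
    (hy : τ + β n < h y) : X.F X.a + κ * X.scale q P n ^ ℓ ≤ y := by
  obtain ⟨m, hm, hβ, hs⟩ := X.exists_even_scale_le hc n
  have h1 := X.semiconj_closeReturn H hc ha m
  rw [hm.neg_one_pow, one_mul] at h1
  have hd := X.returnDist_mem H hc ha m
  have h2 := hr _ ⟨hd.1.le, hd.2⟩
  have h3 : X.scale q P n ^ ℓ ≤ X.returnDist q P m ^ ℓ :=
    Real.rpow_le_rpow (X.scale_mem H hc ha n).1.le hs hℓ
  have h4 := mul_le_mul_of_nonneg_left h3 hκ
  rw [X.returnDist_of_even H hc ha hm, add_sub_cancel, X.flat X.b ⟨X.hab.le, le_rfl⟩,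
    ← X.returnDist_of_even H hc ha hm] at h2
  have h5 := H.map (X.closeReturn q P m)
  linarith [H.lt_of_lt (by linarith : h (X.F (X.closeReturn q P m)) < h y)]

theorem le_sub_mul_scale {κ : ℝ} (hκ : 0 ≤ κ) (hℓ : 0 ≤ ℓ)
    (hl : ∀ t ∈ Set.Icc (0 : ℝ) 1, κ * t ^ ℓ ≤ X.F X.a - X.F (X.a - t)) {n : ℕ} {y : ℝ}
    (hy : h y < τ - β n) : y ≤ X.F X.a - κ * X.scale q P n ^ ℓ := by
  obtain ⟨m, hm, hβ, hs⟩ := X.exists_odd_scale_le hc n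
  have h1 := X.semiconj_closeReturn H hc ha m
  rw [hm.neg_one_pow, neg_one_mul] at h1
  have hd := X.returnDist_mem H hc ha m
  have h2 := hl _ ⟨hd.1.le, hd.2⟩
  have h3 : X.scale q P n ^ ℓ ≤ X.returnDist q P m ^ ℓ :=
    Real.rpow_le_rpow (X.scale_mem H hc ha n).1.le hs hℓ
  have h4 := mul_le_mul_of_nonneg_left h3 hκ
  rw [X.returnDist_of_odd H hc ha hm, sub_sub_cancel,
    ← X.returnDist_of_odd H hc ha hm] at h2
  have h5 := H.map (X.closeReturn q P m)
  linarith [H.lt_of_lt (by linarith : h y < h (X.F (X.closeReturn q P m)))]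

/-- Some orbit segment of length `q (n + 1)` expands definitely: the interval between the flat
interval and its `n`-th closest return is mapped over the flat interval. -/
theorem exists_le_prod_deriv (hℓ : 1 < ℓ) (n : ℕ) :
    ∃ y, X.b - X.a ≤ ∏ i ∈ Finset.range (q (n + 1)), deriv X.F (X.F^[i] y) := by
  suffices hs : ∃ u v, u < v ∧ v ≤ u + 1 ∧ h u + q (n + 1) * τ < P (n + 1) ∧
      P (n + 1) < h v + q (n + 1) * τ by
    obtain ⟨u, v, huv, huv1, hu, hv⟩ := hs
    obtain ⟨y, -, hy⟩ := X.exists_prod_deriv_eq_slope hℓ (q (n + 1)) huv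
    refine ⟨y, ?_⟩
    have h1 : X.F^[q (n + 1)] u < X.a + P (n + 1) := H.lt_of_lt (by
      rw [H.iterate, H.add_int, ha, zero_add]; exact hu)
    have h2 : X.b + P (n + 1) < X.F^[q (n + 1)] v := H.lt_of_lt (by
      rw [H.iterate, H.add_int, X.semiconj_b H ha, zero_add]; exact hv)
    rw [hy, le_div_iff₀ (by linarith)]
    nlinarith [X.hab]
  have h0 := X.semiconj_closeReturn H hc ha n
  have he := hc.error (n + 1)
  have hβ := hc.β_pos (n + 1)
  have hβ' := hc.β_succ_lt n
  rcases n.even_or_odd with hn | hn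
  · have hz := X.closeReturn_mem_of_even H hc ha hn
    rw [hn.neg_one_pow, one_mul] at h0
    rw [hn.add_one.neg_one_pow, neg_one_mul] at he
    refine ⟨X.b, X.closeReturn q P n, hz.1, by linarith [hz.2, X.hab], ?_, ?_⟩
    · rw [X.semiconj_b H ha]
      linarith
    · rw [h0]
      linarith
  · have hz := X.closeReturn_mem_of_odd H hc ha hn
    rw [hn.neg_one_pow, neg_one_mul] at h0
    rw [hn.add_one.neg_one_pow, one_mul] at he
    refine ⟨X.closeReturn q P n, X.a, hz.2, by linarith [hz.1, X.hab], ?_, ?_⟩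
    · rw [h0]
      linarith
    · rw [ha]
      linarith

/-- Some orbit segment of length `q m` stays away from the flat interval and is not too
expanding. -/
theorem exists_prod_deriv_le (hℓ : 1 < ℓ) {κ : ℝ} (hκ : 0 < κ)
    (hr : ∀ t ∈ Set.Icc (0 : ℝ) 1, κ * t ^ ℓ ≤ X.F (X.b + t) - X.F X.b)
    (hl : ∀ t ∈ Set.Icc (0 : ℝ) 1, κ * t ^ ℓ ≤ X.F X.a - X.F (X.a - t)) (m : ℕ) :
    ∃ y, (∀ j < q m, reduceMod X.a (X.F^[j] y) ∈
        Set.Icc (X.b + X.scale q P (m + 5)) (X.a + 1 - X.scale q P (m + 5))) ∧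
      ∏ j ∈ Finset.range (q m), deriv X.F (X.F^[j] y) ≤ 1 / (κ * X.scale q P (m + 5) ^ ℓ) := by
  obtain ⟨u, v, hlen, huv1, hu, hv⟩ : ∃ u v, κ * X.scale q P (m + 5) ^ ℓ ≤ v - u ∧ v ≤ u + 1 ∧
      τ - β (m + 5) ≤ h u ∧ h v ≤ τ + β (m + 5) := by
    have hβ := hc.β_pos (m + 5)
    have h0 := X.semiconj_closeReturn H hc ha (m + 5)
    have hd := X.returnDist_mem H hc ha (m + 5)
    have h3 : κ * X.scale q P (m + 5) ^ ℓ ≤ κ * X.returnDist q P (m + 5) ^ ℓ :=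
      mul_le_mul_of_nonneg_left (Real.rpow_le_rpow (X.scale_mem H hc ha _).1.le (min_le_left _ _)
        (by linarith)) hκ.le
    rcases (m + 5).even_or_odd with hn | hn
    · have hz := X.closeReturn_mem_of_even H hc ha hn
      rw [hn.neg_one_pow, one_mul] at h0
      have h2 := hr _ ⟨hd.1.le, hd.2⟩
      rw [X.returnDist_of_even H hc ha hn, add_sub_cancel, X.flat X.b ⟨X.hab.le, le_rfl⟩] at h2
      rw [X.returnDist_of_even H hc ha hn] at h3
      refine ⟨X.F X.a, X.F (X.closeReturn q P (m + 5)), by linarith, ?_, ?_, ?_⟩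
      · rw [← X.degree_one]
        exact X.mono hz.2.le
      · rw [H.map, ha]
        linarith
      · rw [H.map, h0]
        linarith
    · have hz := X.closeReturn_mem_of_odd H hc ha hn
      rw [hn.neg_one_pow, neg_one_mul] at h0
      have h2 := hl _ ⟨hd.1.le, hd.2⟩
      rw [X.returnDist_of_odd H hc ha hn, sub_sub_cancel] at h2
      rw [X.returnDist_of_odd H hc ha hn] at h3
      refine ⟨X.F (X.closeReturn q P (m + 5)), X.F X.a, by linarith, ?_, ?_, ?_⟩
      · rw [← X.degree_one]
        exact X.mono (by linarith [hz.1, X.hab])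
      · rw [H.map, h0]
        linarith
      · rw [H.map, ha]
        linarith
  have hpos : 0 < κ * X.scale q P (m + 5) ^ ℓ :=
    mul_pos hκ (Real.rpow_pos_of_pos (X.scale_mem H hc ha _).1 _)
  obtain ⟨y, hy, hslope⟩ := X.exists_prod_deriv_eq_slope hℓ (q m) (by linarith : u < v)
  refine ⟨y, fun j hj => ?_, ?_⟩
  · have hy1 := H.mono hy.1.le
    have hy2 := H.mono hy.2.le
    obtain ⟨k, hk⟩ := H.reduceMod_iterate X.a y j
    have hmem := H.reduceMod_mem_Icc ha (X.F^[j] y)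
    have h1 := hc.two_mul_β_lt_abs (by omega : 1 ≤ j + 1) hj (-k)
    have h2 := hc.two_mul_β_lt_abs (by omega : 1 ≤ j + 1) hj (1 - k)
    push_cast at h1 h2
    set x := reduceMod X.a (X.F^[j] y)
    constructor
    · refine X.add_scale_le H hc ha ?_
      by_contra! hcon
      refine absurd h1 (not_lt.2 (abs_le.2 ⟨?_, ?_⟩)) <;> linarith [hmem.1]
    · have h3 : h (x - 1) = h x - 1 := by
        have := H.add_one (x - 1)
        rw [sub_add_cancel] at this
        linarith
      have h4 : h (x - 1) < -β (m + 5) := by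
        rw [h3]
        by_contra! hcon
        refine absurd h2 (not_lt.2 (abs_le.2 ⟨?_, ?_⟩)) <;> linarith [hmem.2]
      linarith [X.le_sub_scale H hc ha h4]
  · rw [hslope]
    gcongr
    exact X.iterate_sub_le_one _ huv1

end Distortion

/-- A telescoping sum restricted to the levels exceeded by `s`. -/
theorem sum_ite_lt_le {μ : ℕ → ℝ} (hμ : Monotone μ) (s : ℝ) (M N : ℕ) :
    ∑ k ∈ Finset.Ico M N, (if μ (k + 1) < s then μ (k + 1) - μ k else 0) ≤ max 0 (s - μ M) := by
  induction N with
  | zero => simp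
  | succ N ih =>
    rcases lt_or_ge N M with hN | hN
    · rw [Finset.Ico_eq_empty (by omega), Finset.sum_empty]
      exact le_max_left _ _
    rw [Finset.sum_Ico_succ_top hN]
    split_ifs with hs
    · have h1 : ∑ k ∈ Finset.Ico M N, (if μ (k + 1) < s then μ (k + 1) - μ k else 0) ≤
          ∑ k ∈ Finset.Ico M N, (μ (k + 1) - μ k) :=
        Finset.sum_le_sum fun k _ => by
          split_ifs
          · exact le_rfl
          · exact sub_nonneg.2 (hμ k.le_succ)
      rw [Finset.sum_Ico_sub _ hN] at h1
      refine le_max_of_le_right ?_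
      linarith
    · simpa using ih

/-- If the slope of an affine function is at most that of another one on arbitrarily large
integers, it is at most that. -/
theorem le_of_forall_natCast_mul_le {Q : ℕ → ℕ} (hQ : ∀ n, n ≤ Q n) {A B E : ℝ}
    (hle : ∀ n, Q n * A ≤ Q n * B + E) : A ≤ B := by
  by_contra! hlt
  obtain ⟨n, hn⟩ := exists_nat_gt (E / (A - B))
  rw [div_lt_iff₀ (sub_pos.2 hlt)] at hn
  have h1 : (n : ℝ) ≤ Q n := by exact_mod_cast hQ n
  have h2 := mul_le_mul_of_nonneg_right h1 (sub_pos.2 hlt).le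
  linarith [hle n]

section LogSums

variable (H : IsRotationSemiconj X.F h τ) (hc : IsConvergents τ q P β) (ha : h X.a = 0)
  {L : NNReal} {g : ℝ → ℝ} (hg : LipschitzWith L g)

include H hc ha hg

/-- Sums of `log F'`, with the logarithmic singularities truncated at `D`, along two orbit
segments whose lengths are denominators of convergents are comparable. -/
theorem truncated_sum_le {D : ℝ} (hD : D ∈ Set.Ioc (0 : ℝ) 1) {s : ℝ} (hs : 0 ≤ s)
    (x y : ℝ) (m n : ℕ) :
    let ψ : ℝ → ℝ := fun t =>
      g t + s * (Real.log (max (t - X.b) D) + Real.log (max (X.a + 1 - t) D))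
    q m * ∑ i ∈ Finset.range (q n), ψ (reduceMod X.a (X.F^[i] x)) ≤
      q n * ∑ i ∈ Finset.range (q m), ψ (reduceMod X.a (X.F^[i] y)) +
        3 * (q n + q m) * (3 * L + 2 * s * (-Real.log D)) := by
  intro ψ
  have hab := X.hab
  have hL : (0 : ℝ) ≤ L := L.2
  have hgd : ∀ u v, u ≤ v → |g v - g u| ≤ L * (v - u) := fun u v huv => by
    have := hg.dist_le_mul v u
    rwa [Real.dist_eq, Real.dist_eq, abs_of_nonneg (sub_nonneg.2 huv)] at this
  have hlogD : Real.log D ≤ 0 := Real.log_nonpos hD.1.le hD.2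
  have hlog : ∀ t ≤ (1 : ℝ), Real.log (max t D) ∈ Set.Icc (Real.log D) 0 := fun t ht =>
    ⟨Real.log_le_log hD.1 (le_max_right _ _),
      Real.log_nonpos (hD.1.le.trans (le_max_right _ _)) (max_le ht hD.2)⟩
  have hlogm : ∀ u v : ℝ, u ≤ v → Real.log (max u D) ≤ Real.log (max v D) := fun u v huv =>
    Real.log_le_log (lt_max_of_lt_right hD.1) (max_le_max_right _ huv)
  have e1 := H.denjoy_koksma hc ha (φ := fun t => g t + L * t) (lo := g X.a + L * X.a)
    (W := 2 * L) (fun u _ v _ huv => by have := abs_le.1 (hgd u v huv); dsimp only; linarith)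
    (by positivity) (fun t ht => by
      have h1 := abs_le.1 (hgd _ t ht.1)
      have h2 : L * (t - X.a) ≤ L * 1 := mul_le_mul_of_nonneg_left (by linarith [ht.2]) hL
      constructor <;> linarith) x y m n
  have e2 := H.denjoy_koksma hc ha (φ := fun t => L * t) (lo := L * X.a) (W := L)
    (fun u _ v _ huv => mul_le_mul_of_nonneg_left huv hL) hL (fun t ht => by
      have h2 : L * (t - X.a) ≤ L * 1 := mul_le_mul_of_nonneg_left (by linarith [ht.2]) hL
      have h3 := mul_nonneg hL (sub_nonneg.2 ht.1)
      constructor <;> linarith) x y m n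
  have e3 := H.denjoy_koksma hc ha (φ := fun t => Real.log (max (t - X.b) D))
    (lo := Real.log D) (W := -Real.log D)
    (fun u _ v _ huv => hlogm _ _ (by linarith)) (by linarith) (fun t ht => by
      simpa using hlog (t - X.b) (by linarith [ht.2])) x y m n
  have e4 := H.denjoy_koksma hc ha (φ := fun t => -Real.log (max (X.a + 1 - t) D))
    (lo := 0) (W := -Real.log D)
    (fun u _ v _ huv => neg_le_neg (hlogm _ _ (by linarith))) (by linarith) (fun t ht => by
      have := hlog (X.a + 1 - t) (by linarith [ht.1])
      constructor <;> linarith [this.1, this.2]) x y m n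
  have hsplit : ∀ t, ψ t = (g t + L * t) - L * t +
      s * (Real.log (max (t - X.b) D) - -Real.log (max (X.a + 1 - t) D)) := fun t => by
    simp only [ψ]
    ring
  simp only [hsplit, Finset.sum_add_distrib, Finset.sum_sub_distrib, ← Finset.mul_sum]
  simp only [Finset.sum_add_distrib, ← Finset.mul_sum] at e1 e2
  have e3' := mul_le_mul_of_nonneg_left (abs_le.1 e3).2 hs
  have e4' := mul_le_mul_of_nonneg_left (abs_le.1 e4).1 hs
  linarith [(abs_le.1 e1).2, (abs_le.1 e2).1]

theorem sum_log_scale_le (hℓ : 1 < ℓ)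
    (hlog : ∀ x ∈ Set.Ioo X.b (X.a + 1), Real.log (deriv X.F x) =
      g x + (ℓ - 1) * (Real.log (x - X.b) + Real.log (X.a + 1 - x)))
    {κ : ℝ} (hκ : 0 < κ)
    (hr : ∀ t ∈ Set.Icc (0 : ℝ) 1, κ * t ^ ℓ ≤ X.F (X.b + t) - X.F X.b)
    (hl : ∀ t ∈ Set.Icc (0 : ℝ) 1, κ * t ^ ℓ ≤ X.F X.a - X.F (X.a - t)) (m N : ℕ) :
    let μ : ℕ → ℝ := fun k => -Real.log (X.scale q P k)
    q m * ((ℓ - 1) * ∑ k ∈ Finset.Ico (m + 5) N, (μ (k + 1) - μ k) * β (k + 2)) ≤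
      -Real.log κ + ℓ * μ (m + 5) + 3 * (3 * L + 2 * (ℓ - 1) * μ (m + 5)) := by
  intro μ
  have hs : 0 ≤ ℓ - 1 := by linarith
  have hD := X.scale_mem H hc ha
  have hμ : Monotone μ := fun i j hij =>
    neg_le_neg (Real.log_le_log (hD j).1 (X.scale_anti H hc ha hij))
  set D := X.scale q P (m + 5)
  let ψ : ℝ → ℝ := fun t =>
    g t + (ℓ - 1) * (Real.log (max (t - X.b) D) + Real.log (max (X.a + 1 - t) D))
  have hD0 : 0 < D := (hD (m + 5)).1
  obtain ⟨y, hyfar, hyprod⟩ := X.exists_prod_deriv_le H hc ha hℓ hκ hr hl m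
  have hΛ' : ∑ j ∈ Finset.range (q m), ψ (reduceMod X.a (X.F^[j] y)) ≤
      -Real.log κ + ℓ * μ (m + 5) := by
    have h1 : ∀ j ∈ Finset.range (q m), reduceMod X.a (X.F^[j] y) ∈ Set.Ioo X.b (X.a + 1) :=
      fun j hj => by
        have := hyfar j (Finset.mem_range.1 hj)
        exact ⟨by linarith [this.1], by linarith [this.2]⟩
    have h2 : ∑ j ∈ Finset.range (q m), ψ (reduceMod X.a (X.F^[j] y)) =
        ∑ j ∈ Finset.range (q m), Real.log (deriv X.F (X.F^[j] y)) :=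
      Finset.sum_congr rfl fun j hj => by
        have := hyfar j (Finset.mem_range.1 hj)
        rw [← X.deriv_reduceMod, hlog _ (h1 j hj)]
        simp only [ψ]
        rw [max_eq_left (by linarith [this.1]), max_eq_left (by linarith [this.2])]
    have h3 : ∀ j ∈ Finset.range (q m), 0 < deriv X.F (X.F^[j] y) := fun j hj => by
      rw [← X.deriv_reduceMod]
      exact X.deriv_pos _ (h1 j hj)
    rw [h2, ← Real.log_prod fun j hj => (h3 j hj).ne']
    refine (Real.log_le_log (Finset.prod_pos h3) hyprod).trans_eq ?_
    rw [one_div, Real.log_inv, Real.log_mul hκ.ne' (Real.rpow_pos_of_pos hD0 _).ne',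
      Real.log_rpow hD0]
    simp only [μ]
    ring
  refine le_of_forall_natCast_mul_le (Q := fun n => q (n + 1))
    (fun n => n.le_succ.trans (hc.le_q _))
    (E := q m * (3 * (3 * L + 2 * (ℓ - 1) * μ (m + 5)) - Real.log (X.b - X.a) +
      (ℓ - 1) * ∑ k ∈ Finset.Ico (m + 5) N, (μ (k + 1) - μ k) * 6)) fun n => ?_
  obtain ⟨x, hxprod⟩ := X.exists_le_prod_deriv H hc ha hℓ n
  have hba : 0 < X.b - X.a := sub_pos.2 X.hab
  have hne : ∀ i ∈ Finset.range (q (n + 1)), deriv X.F (X.F^[i] x) ≠ 0 :=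
    Finset.prod_ne_zero_iff.1 (hba.trans_le hxprod).ne'
  have hx : ∀ i ∈ Finset.range (q (n + 1)), reduceMod X.a (X.F^[i] x) ∈ Set.Ioo X.b (X.a + 1) :=
    fun i hi => X.reduceMod_mem_Ioo hℓ (hne i hi)
  let ind : ℕ → ℕ → ℝ := fun i k =>
    if min (reduceMod X.a (X.F^[i] x) - X.b) (X.a + 1 - reduceMod X.a (X.F^[i] x)) <
      X.scale q P (k + 1) then μ (k + 1) - μ k else 0
  have hpt : ∀ i ∈ Finset.range (q (n + 1)), Real.log (deriv X.F (X.F^[i] x)) ≤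
      ψ (reduceMod X.a (X.F^[i] x)) -
        (ℓ - 1) * ∑ k ∈ Finset.Ico (m + 5) N, ind i k := fun i hi => by
    have hxi := hx i hi
    rw [← X.deriv_reduceMod, hlog _ hxi]
    simp only [ind, ψ]
    set t := reduceMod X.a (X.F^[i] x)
    have ht1 : 0 < t - X.b := sub_pos.2 hxi.1
    have ht2 : 0 < X.a + 1 - t := sub_pos.2 hxi.2
    have hδ : 0 < min (t - X.b) (X.a + 1 - t) := lt_min ht1 ht2
    have h1 : ∑ k ∈ Finset.Ico (m + 5) N, (if min (t - X.b) (X.a + 1 - t) < X.scale q P (k + 1)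
        then μ (k + 1) - μ k else 0) ≤
          max 0 (-Real.log (min (t - X.b) (X.a + 1 - t)) - μ (m + 5)) := by
      refine le_trans (le_of_eq ?_) (sum_ite_lt_le hμ _ (m + 5) N)
      refine Finset.sum_congr rfl fun k _ => ?_
      refine if_congr ?_ rfl rfl
      simp only [μ, neg_lt_neg_iff, Real.log_lt_log_iff hδ (hD _).1]
    have h2 : Real.log (t - X.b) ≤ Real.log (max (t - X.b) D) :=
      Real.log_le_log ht1 (le_max_left _ _)
    have h3 : Real.log (X.a + 1 - t) ≤ Real.log (max (X.a + 1 - t) D) :=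
      Real.log_le_log ht2 (le_max_left _ _)
    have h4 : Real.log D ≤ Real.log (max (t - X.b) D) := Real.log_le_log hD0 (le_max_right _ _)
    have h5 : Real.log D ≤ Real.log (max (X.a + 1 - t) D) :=
      Real.log_le_log hD0 (le_max_right _ _)
    have h6 : max 0 (-Real.log (min (t - X.b) (X.a + 1 - t)) - μ (m + 5)) ≤
        (Real.log (max (t - X.b) D) + Real.log (max (X.a + 1 - t) D)) -
          (Real.log (t - X.b) + Real.log (X.a + 1 - t)) := by
      refine max_le (by linarith) ?_
      simp only [μ]
      rcases min_choice (t - X.b) (X.a + 1 - t) with hm | hm <;> rw [hm] <;> linarith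
    have h7 := mul_le_mul_of_nonneg_left (h1.trans h6) hs
    linarith
  have hΛ : Real.log (X.b - X.a) ≤ ∑ i ∈ Finset.range (q (n + 1)),
      ψ (reduceMod X.a (X.F^[i] x)) -
        (ℓ - 1) * ∑ k ∈ Finset.Ico (m + 5) N,
          (μ (k + 1) - μ k) * (q (n + 1) * β (k + 2) - 6) := by
    have h1 := Real.log_le_log hba hxprod
    rw [Real.log_prod hne] at h1
    refine h1.trans ((Finset.sum_le_sum hpt).trans ?_)
    rw [Finset.sum_sub_distrib, ← Finset.mul_sum, Finset.sum_comm]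
    refine sub_le_sub_left (mul_le_mul_of_nonneg_left (Finset.sum_le_sum fun k _ => ?_) hs) _
    simp only [ind]
    rw [← Finset.sum_filter, Finset.sum_const, nsmul_eq_mul, mul_comm]
    exact mul_le_mul_of_nonneg_right (X.le_card_visits H hc ha x (k + 1) (n + 1))
      (sub_nonneg.2 (hμ k.le_succ))
  have hDK := X.truncated_sum_le H hc ha hg (D := D) (hD (m + 5)) hs x y m (n + 1)
  have hqm : (0 : ℝ) ≤ q m := Nat.cast_nonneg _
  have hqn : (0 : ℝ) ≤ q (n + 1) := Nat.cast_nonneg _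
  have h1 := mul_le_mul_of_nonneg_left hΛ hqm
  have h2 := mul_le_mul_of_nonneg_left hΛ' hqn
  have h3 : ∑ k ∈ Finset.Ico (m + 5) N, (μ (k + 1) - μ k) * (q (n + 1) * β (k + 2) - 6) =
      q (n + 1) * ∑ k ∈ Finset.Ico (m + 5) N, (μ (k + 1) - μ k) * β (k + 2) -
        ∑ k ∈ Finset.Ico (m + 5) N, (μ (k + 1) - μ k) * 6 := by
    rw [Finset.mul_sum, ← Finset.sum_sub_distrib]
    exact Finset.sum_congr rfl fun k _ => by ring
  rw [h3] at h1
  have hμD : -Real.log D = μ (m + 5) := rfl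
  simp only [hμD] at hDK
  linarith

end LogSums

/-- A sequence whose tail sums are controlled by their first terms decays
geometrically. -/
theorem le_mul_pow_of_sum_Ico_le {r : ℕ → ℝ} {E : ℝ} (hE : 0 < E) {m₀ : ℕ}
    (hsum : ∀ m ≥ m₀, ∀ N, ∑ k ∈ Finset.Ico (m + 1) N, r k ≤ E * r m) (j : ℕ) :
    r (m₀ + j) ≤ (1 + E) * r m₀ * (E / (1 + E)) ^ j := by
  have hE1 : 0 < 1 + E := by linarith
  have hstep : ∀ m ≥ m₀, ∀ N > m, ∑ k ∈ Finset.Ico (m + 1) N, r k ≤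
      E / (1 + E) * ∑ k ∈ Finset.Ico m N, r k := fun m hm N hN => by
    rw [Finset.sum_eq_sum_Ico_succ_bot hN, div_mul_eq_mul_div, le_div_iff₀ hE1]
    linarith [hsum m hm N]
  have hpow : ∀ i, ∀ N > m₀ + i, ∑ k ∈ Finset.Ico (m₀ + i) N, r k ≤
      (E / (1 + E)) ^ i * ∑ k ∈ Finset.Ico m₀ N, r k := fun i => by
    induction i with
    | zero => simp
    | succ i ih =>
      intro N hN
      refine (hstep (m₀ + i) (by omega) N (by omega)).trans ?_
      rw [pow_succ', mul_assoc]
      exact mul_le_mul_of_nonneg_left (ih N (by omega)) (by positivity)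
  have h1 := hpow j (m₀ + j + 1) (by omega)
  rw [Finset.sum_eq_sum_Ico_succ_bot (by omega : m₀ < m₀ + j + 1), Nat.Ico_succ_singleton,
    Finset.sum_singleton] at h1
  refine h1.trans ?_
  rw [mul_comm]
  refine mul_le_mul_of_nonneg_right ?_ (by positivity)
  linarith [hsum m₀ le_rfl (m₀ + j + 1)]

/-- Summation by parts: control of the weighted increments of `w` gives control of the tail sums
of `w / q`. -/
theorem sum_Ico_div_le {w q : ℕ → ℝ} (hw : ∀ k, 0 ≤ w k) (hq : ∀ k, 0 < q k)
    (hadd : ∀ k, q (k + 1) + q k ≤ q (k + 2)) {B : ℝ} (hB : ∀ k, q (k + 1) ≤ B * q k)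
    {C : ℝ} {m : ℕ} (hm : 1 ≤ m)
    (hsum : ∀ N, ∑ k ∈ Finset.Ico m N, (w (k + 1) - w k) / q k ≤ C * (w m / q m)) (N : ℕ) :
    ∑ k ∈ Finset.Ico (m + 1) N, w k / q k ≤ B * (C + 1) * (w m / q m) := by
  have hB0 : 0 < B := pos_of_mul_pos_left ((hq 1).trans_le (hB 0)) (hq 0).le
  have hr : ∀ k, 0 ≤ w k / q k := fun k => div_nonneg (hw k) (hq k).le
  have hterm : ∀ k ≥ 1, w (k + 1) / q (k + 1) / B + (w (k + 1) / q (k + 1) - w k / q k) ≤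
      (w (k + 1) - w k) / q k := by
    intro k hk
    obtain ⟨k, rfl⟩ := Nat.exists_eq_add_of_le' hk
    have h1 : 1 / B + 1 ≤ q (k + 2) / q (k + 1) := by
      rw [le_div_iff₀ (hq _), add_mul, one_mul, one_div_mul_eq_div]
      have : q (k + 1) / B ≤ q k := by
        rw [div_le_iff₀ hB0, mul_comm]
        exact hB k
      linarith [hadd k]
    have h2 := mul_le_mul_of_nonneg_left h1 (hr (k + 2))
    have h3 : w (k + 2) / q (k + 2) * (q (k + 2) / q (k + 1)) = w (k + 2) / q (k + 1) := by
      have := (hq (k + 2)).ne'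
      field_simp
    rw [h3, mul_add, mul_one_div, mul_one] at h2
    rw [sub_div]
    linarith
  rcases lt_or_ge m N with hN | hN
  · obtain ⟨N, rfl⟩ := Nat.exists_eq_add_of_le' (hN : m + 1 ≤ N)
    have hmN : m ≤ m + N := by omega
    have h1 := Finset.sum_le_sum fun k (hk : k ∈ Finset.Ico m (m + N)) =>
      hterm k (hm.trans (Finset.mem_Ico.1 hk).1)
    rw [Finset.sum_add_distrib, Finset.sum_Ico_sub (fun k => w k / q k) hmN,
      ← Finset.sum_div] at h1
    have h2 : ∑ k ∈ Finset.Ico m (m + N), w (k + 1) / q (k + 1) ≤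
        B * (C + 1) * (w m / q m) := by
      rw [mul_assoc, ← div_le_iff₀' hB0]
      linarith [hsum (m + N), hr (m + N)]
    rwa [show N + (m + 1) = m + N + 1 by ring,
      ← Finset.sum_Ico_add' (fun k => w k / q k) m (m + N) 1]
  · rw [Finset.Ico_eq_empty (by omega), Finset.sum_empty]
    have h1 := hsum m
    rw [Finset.Ico_self, Finset.sum_empty] at h1
    have := hr m
    have : 0 ≤ (C + 1) * (w m / q m) := by linarith
    rw [mul_assoc]
    positivity

section Conclusion

variable (H : IsRotationSemiconj X.F h τ) (hc : IsConvergents τ q P β) (ha : h X.a = 0)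

include H hc ha

theorem exists_one_sub_log_scale_le (hℓ : 1 < ℓ) {B : ℝ} (hB : ∀ n, (q (n + 1) : ℝ) ≤ B * q n) :
    ∃ K > 0, ∃ C ∈ Set.Ioo (0 : ℝ) 1, ∀ n ≥ 5,
      1 - Real.log (X.scale q P n) ≤ K * C ^ n * q n := by
  obtain ⟨L, g, hg, hlog⟩ := X.exists_lipschitz_log_deriv hℓ
  obtain ⟨κ, hκ, hr, hl⟩ := X.exists_mul_rpow_le hℓ
  have hD := X.scale_mem H hc ha
  have hs : 0 < ℓ - 1 := by linarith
  have hq : ∀ k, (0 : ℝ) < q k := fun k => by exact_mod_cast hc.q_pos k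
  have hadd : ∀ k, (q (k + 1) : ℝ) + q k ≤ q (k + 2) := fun k => by exact_mod_cast hc.q_add_le k
  have hB0 : 0 < B := pos_of_mul_pos_left ((hq 1).trans_le (hB 0)) (hq 0).le
  have hBpow : ∀ j n, (q (n + j) : ℝ) ≤ B ^ j * q n := fun j n => by
    induction j with
    | zero => simp
    | succ j ih =>
      rw [pow_succ', mul_assoc]
      exact (hB (n + j)).trans (mul_le_mul_of_nonneg_left ih hB0.le)
  let w : ℕ → ℝ := fun k => 1 - Real.log (X.scale q P k)
  have hw1 : ∀ k, 1 ≤ w k := fun k => by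
    have := Real.log_nonpos (hD k).1.le (hD k).2
    simp only [w]
    linarith
  have hw : ∀ k, w k ≤ w (k + 1) := fun k =>
    sub_le_sub_left (Real.log_le_log (hD _).1 (X.scale_anti H hc ha k.le_succ)) _
  let A : ℝ := |Real.log κ| + 9 * L + ℓ + 6 * (ℓ - 1)
  have hA : 0 ≤ A := by
    have := abs_nonneg (Real.log κ)
    have : (0 : ℝ) ≤ L := L.2
    simp only [A]
    linarith
  let C := B ^ 5 * (2 * B ^ 3) * (A / (ℓ - 1))
  have hC : 0 ≤ C := by positivity
  have hmain : ∀ m ≥ 5, ∀ N, ∑ k ∈ Finset.Ico m N, (w (k + 1) - w k) / q k ≤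
      C * (w m / q m) := by
    intro m hm N
    obtain ⟨m, rfl⟩ := Nat.exists_eq_add_of_le' hm
    have h1 := X.sum_log_scale_le H hc ha hg hℓ hlog hκ hr hl m N
    simp only at h1
    have h2 : -Real.log κ + ℓ * -Real.log (X.scale q P (m + 5)) +
        3 * (3 * L + 2 * (ℓ - 1) * -Real.log (X.scale q P (m + 5))) ≤ A * w (m + 5) := by
      have e1 : 0 ≤ (|Real.log κ| + 9 * L) * -Real.log (X.scale q P (m + 5)) :=
        mul_nonneg (by positivity) (neg_nonneg.2 (Real.log_nonpos (hD _).1.le (hD _).2))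
      have e2 := neg_abs_le (Real.log κ)
      simp only [A, w]
      linarith
    have h3 : ∑ k ∈ Finset.Ico (m + 5) N, (w (k + 1) - w k) / q k ≤
        2 * B ^ 3 * ∑ k ∈ Finset.Ico (m + 5) N,
          (-Real.log (X.scale q P (k + 1)) - -Real.log (X.scale q P k)) * β (k + 2) := by
      rw [Finset.mul_sum]
      refine Finset.sum_le_sum fun k _ => ?_
      have e1 : (q k : ℝ)⁻¹ ≤ 2 * B ^ 3 * β (k + 2) := by
        rw [inv_le_iff_one_le_mul₀ (hq k)]
        refine (hc.one_le_q_mul_β (k + 2)).trans ?_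
        have := mul_le_mul_of_nonneg_right (hBpow 3 k) (hc.β_pos (k + 2)).le
        linarith
      have e2 := mul_le_mul_of_nonneg_left e1 (sub_nonneg.2 (hw k))
      rw [div_eq_mul_inv]
      refine e2.trans_eq ?_
      simp only [w]
      ring
    have h4 := hBpow 5 m
    set S := ∑ k ∈ Finset.Ico (m + 5) N,
      (-Real.log (X.scale q P (k + 1)) - -Real.log (X.scale q P k)) * β (k + 2)
    have hS : 0 ≤ S := Finset.sum_nonneg fun k _ =>
      mul_nonneg (by have := hw k; simp only [w] at this; linarith) (hc.β_pos _).le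
    have h5 : q (m + 5) * S ≤ B ^ 5 * (A / (ℓ - 1)) * w (m + 5) := by
      have e1 := mul_le_mul_of_nonneg_right h4 hS
      have e2 : q m * S ≤ A / (ℓ - 1) * w (m + 5) := by
        rw [div_mul_eq_mul_div, le_div_iff₀ hs]
        linarith [h1.trans h2]
      have e3 := mul_le_mul_of_nonneg_left e2 (pow_nonneg hB0.le 5)
      linarith
    refine h3.trans ?_
    rw [← mul_div_assoc, le_div_iff₀ (hq _)]
    have h6 := mul_le_mul_of_nonneg_left h5 (by positivity : 0 ≤ 2 * B ^ 3)
    simp only [C]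
    linarith
  have hE : 0 < B * (C + 1) := by positivity
  have hdecay := le_mul_pow_of_sum_Ico_le (r := fun k => w k / q k) (m₀ := 5) hE
    fun m hm N =>
      sum_Ico_div_le (fun k => by linarith [hw1 k]) hq hadd hB (by omega) (hmain m hm) N
  set E := B * (C + 1)
  have hE1 : 0 < 1 + E := by linarith
  have hθ : 0 < E / (1 + E) := by positivity
  have hr5 : 0 < w 5 / q 5 := div_pos (by linarith [hw1 5]) (hq 5)
  refine ⟨(1 + E) * (w 5 / q 5) / (E / (1 + E)) ^ 5, by positivity, E / (1 + E), ⟨hθ, ?_⟩,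
    fun n hn => ?_⟩
  · rw [div_lt_one hE1]
    linarith
  · obtain ⟨j, rfl⟩ := Nat.exists_eq_add_of_le hn
    have h1 := hdecay j
    rw [div_le_iff₀ (hq _)] at h1
    refine h1.trans_eq ?_
    rw [pow_add]
    field_simp

theorem mul_scale_le_norm {κ : ℝ} (hκ : 0 ≤ κ) (hℓ : 0 ≤ ℓ)
    (hr : ∀ t ∈ Set.Icc (0 : ℝ) 1, κ * t ^ ℓ ≤ X.F (X.b + t) - X.F X.b)
    (hl : ∀ t ∈ Set.Icc (0 : ℝ) 1, κ * t ^ ℓ ≤ X.F X.a - X.F (X.a - t)) {n : ℕ} (hn : 1 ≤ n)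
    {e : ℝ} (he : X.f^[q n] (e : AddCircle (1 : ℝ)) = X.c) :
    κ * X.scale q P (n + 1) ^ ℓ ≤ ‖X.c - (e : AddCircle (1 : ℝ))‖ := by
  have hsemi : Function.Semiconj (fun x : ℝ => (x : AddCircle (1 : ℝ))) X.F X.f :=
    fun x => (X.isLift x).symm
  have hcF : X.c = (X.F X.a : AddCircle (1 : ℝ)) := X.isLift X.a
  have h1 : (X.F^[q n] e : AddCircle (1 : ℝ)) = (X.F X.a : AddCircle (1 : ℝ)) := by
    rw [← hcF, ← he]
    exact (hsemi.iterate_right (q n)) e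
  obtain ⟨k, hk⟩ : ∃ k : ℤ, X.F^[q n] e = X.F X.a + k := by
    rw [← sub_eq_zero, ← AddCircle.coe_sub, AddCircle.coe_eq_zero_iff] at h1
    obtain ⟨k, hk⟩ := h1
    refine ⟨k, ?_⟩
    rw [zsmul_eq_mul, mul_one] at hk
    linarith
  rw [hcF, ← AddCircle.coe_sub, AddCircle.norm_eq]
  set j : ℤ := round ((1 : ℝ)⁻¹ * (X.F X.a - e))
  have hy : h (e + j) = τ + ((k + j - P n : ℤ) : ℝ) - (-1) ^ n * β n := by
    have h2 := H.iterate e (q n)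
    rw [hk, H.add_int, H.map, ha] at h2
    rw [H.add_int, ← hc.error]
    push_cast
    linarith
  set i : ℤ := k + j - P n
  have hβ : β n + β (n + 1) < 1 := by
    obtain ⟨n, rfl⟩ := Nat.exists_eq_add_of_le' hn
    have h2 := hc.det (n + 1)
    have h3 : 2 ≤ q (n + 2) := by
      have := hc.q_add_le n
      have := hc.q_pos n
      have := hc.q_pos (n + 1)
      omega
    have h4 : (2 : ℝ) ≤ q (n + 2) := by exact_mod_cast h3
    have h5 : (1 : ℝ) ≤ q (n + 1) := by exact_mod_cast hc.q_pos (n + 1)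
    have h6 := mul_le_mul_of_nonneg_right h4 (hc.β_pos (n + 1)).le
    have h7 := mul_le_mul_of_nonneg_right h5 (hc.β_pos (n + 2)).le
    have := hc.β_pos (n + 1)
    simp only [Nat.add_assoc, Nat.reduceAdd] at *
    linarith
  have hβ1 := hc.β_succ_lt n
  have hβ2 := hc.β_pos (n + 1)
  have hsign : (-1 : ℝ) ^ n * β n = β n ∨ (-1 : ℝ) ^ n * β n = -β n := by
    rcases neg_one_pow_eq_or ℝ n with h2 | h2 <;> simp [h2]
  have hfar : τ + β (n + 1) < h (e + j) ∨ h (e + j) < τ - β (n + 1) := by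
    rw [hy]
    rcases lt_trichotomy i 0 with hi | hi | hi
    · have : (i : ℝ) ≤ -1 := by exact_mod_cast (by omega : i ≤ -1)
      right
      rcases hsign with h2 | h2 <;> rw [h2] <;> linarith
    · rw [hi, Int.cast_zero]
      rcases hsign with h2 | h2 <;> rw [h2]
      · right
        linarith
      · left
        linarith
    · have : (1 : ℝ) ≤ i := by exact_mod_cast hi
      left
      rcases hsign with h2 | h2 <;> rw [h2] <;> linarith
  rw [mul_one, le_abs]
  rcases hfar with h2 | h2
  · right
    linarith [X.add_mul_scale_le H hc ha hκ hℓ hr h2]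
  · left
    linarith [X.le_sub_mul_scale H hc ha hκ hℓ hl h2]

end Conclusion

theorem exists_normalized_semiconj :
    ∃ (h : ℝ → ℝ) (k : ℤ), IsRotationSemiconj X.F h (X.rho + k) ∧ h X.a = 0 := by
  obtain ⟨k, hk⟩ := X.rho_lim
  obtain ⟨h, H⟩ := exists_isRotationSemiconj X.mono X.degree_one (hk 0)
  exact ⟨fun x => h x - h X.a, k, ⟨fun x y hxy => sub_le_sub_right (H.mono hxy) _,
    fun x => by rw [H.add_one]; ring, fun x => by rw [H.map]; ring⟩, sub_self _⟩

end CherryMap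

/-- let `f` be a Cherry map of exponent `ℓ ∈ (1,2]` with rotation number of
bounded type. Assume `f⁻¹({c}) = closure U` and, for every `m ≥ 1`, that the preimage
`J_m = f^{−m}({c})` is a closed arc (with endpoints `u m`, `v m` and length `v m − u m`)
not containing `c`. With
`α_n := |(c, J_{q_n})| / (|(c, J_{q_n})| + |J_{q_n}|)`,
there are `K > 0` and `C ∈ (0,1)` such that `(−log α_n)/q_{n+1} ≤ K·Cⁿ` for all large `n`. -/
theorem neg_log_alpha_preimage_bound (ℓ : ℝ) (hℓ : ℓ ∈ Set.Ioc (1 : ℝ) 2)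
    (X : CherryMap ℓ) (hbt : BoundedType X.rho)
    (hpre : X.f ⁻¹' {X.c} = closure X.U)
    (u v : ℕ → ℝ)
    (harc : ∀ m ≥ 1, u m ≤ v m ∧ v m - u m < 1 ∧
      (X.f^[m]) ⁻¹' {X.c} =
        (fun t : ℝ => (t : AddCircle (1 : ℝ))) '' Set.Icc (u m) (v m) ∧
      X.c ∉ (X.f^[m]) ⁻¹' {X.c}) :
    ∃ K > 0, ∃ C ∈ Set.Ioo (0 : ℝ) 1, ∀ᶠ n in atTop,
      (-Real.log
          (distToEnds X.c (u (cfQ X.rho n)) (v (cfQ X.rho n)) /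
            (distToEnds X.c (u (cfQ X.rho n)) (v (cfQ X.rho n)) +
              (v (cfQ X.rho n) - u (cfQ X.rho n))))) / (cfQ X.rho (n + 1) : ℝ)
        ≤ K * C ^ n := by
  obtain ⟨h, k, H, ha⟩ := X.exists_normalized_semiconj
  obtain ⟨P, β, hc⟩ := exists_isConvergents X.rho_mem X.rho_irrational k
  obtain ⟨A, hA⟩ := hbt
  have hℓ1 := hℓ.1
  have hB : ∀ n, (cfQ X.rho (n + 1) : ℝ) ≤ (A + 1 : ℝ) * cfQ X.rho n := fun n => by
    exact_mod_cast cfQ_succ_le X.rho_mem X.rho_irrational hA n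
  obtain ⟨K, hK, C, hC, hscale⟩ := X.exists_one_sub_log_scale_le H hc ha hℓ1 hB
  obtain ⟨κ, hκ, hr, hl⟩ := X.exists_mul_rpow_le hℓ1
  have hlog2 : 0 ≤ Real.log 2 := Real.log_nonneg one_le_two
  have hT : 0 < Real.log 2 + |Real.log κ| + ℓ := by positivity
  set T := Real.log 2 + |Real.log κ| + ℓ
  have hC0 : 0 < C := hC.1
  refine ⟨T * K * C, by positivity, C, hC, ?_⟩
  filter_upwards [eventually_ge_atTop 4] with n hn
  obtain ⟨huv, huv1, hpreim, -⟩ := harc _ (cfQ_pos X.rho_mem X.rho_irrational n)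
  have hend : ∀ e ∈ Set.Icc (u (cfQ X.rho n)) (v (cfQ X.rho n)),
      κ * X.scale (cfQ X.rho) P (n + 1) ^ ℓ ≤ ‖X.c - (e : AddCircle (1 : ℝ))‖ := fun e he => by
    have h1 : (e : AddCircle (1 : ℝ)) ∈ X.f^[cfQ X.rho n] ⁻¹' {X.c} := by
      rw [hpreim]
      exact ⟨e, he, rfl⟩
    exact X.mul_scale_le_norm H hc ha hκ.le (by linarith) hr hl (by omega) h1
  have hG : κ * X.scale (cfQ X.rho) P (n + 1) ^ ℓ ≤
      distToEnds X.c (u (cfQ X.rho n)) (v (cfQ X.rho n)) :=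
    le_min (hend _ ⟨le_rfl, huv⟩) (hend _ ⟨huv, le_rfl⟩)
  have hG1 : distToEnds X.c (u (cfQ X.rho n)) (v (cfQ X.rho n)) ≤ 1 / 2 := by
    refine (min_le_left _ _).trans ?_
    simpa using AddCircle.norm_le_half_period (p := (1 : ℝ)) (x := X.c - u (cfQ X.rho n)) one_ne_zero
  set G := distToEnds X.c (u (cfQ X.rho n)) (v (cfQ X.rho n))
  have hD := X.scale_mem H hc ha (n + 1)
  have hDpow := Real.rpow_pos_of_pos hD.1 ℓ
  have hG0 : 0 < G := (mul_pos hκ hDpow).trans_le hG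
  have hα : κ * X.scale (cfQ X.rho) P (n + 1) ^ ℓ / 2 ≤
      G / (G + (v (cfQ X.rho n) - u (cfQ X.rho n))) := by
    gcongr
    linarith
  have hlogα := Real.log_le_log (by positivity) hα
  rw [Real.log_div (by positivity) two_ne_zero, Real.log_mul hκ.ne' hDpow.ne',
    Real.log_rpow hD.1] at hlogα
  have hμ := Real.log_nonpos hD.1.le hD.2
  have hbound : -Real.log (G / (G + (v (cfQ X.rho n) - u (cfQ X.rho n)))) ≤
      T * (1 - Real.log (X.scale (cfQ X.rho) P (n + 1))) := by
    have h1 := neg_abs_le (Real.log κ)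
    have h2 : 0 ≤ (Real.log 2 + |Real.log κ|) * -Real.log (X.scale (cfQ X.rho) P (n + 1)) :=
      mul_nonneg (by positivity) (by linarith)
    simp only [T]
    linarith
  have hq : (0 : ℝ) < cfQ X.rho (n + 1) := by
    exact_mod_cast cfQ_pos X.rho_mem X.rho_irrational (n + 1)
  rw [div_le_iff₀ hq]
  refine (hbound.trans (mul_le_mul_of_nonneg_left (hscale (n + 1) (by omega)) hT.le)).trans_eq ?_
  rw [pow_succ]
  ring
end

section
/- Let ℓ ∈ (1,2], let M be a positive integer, let (a_n)_{n≥1} be positive integers with a_n ≤ M for all n, and define q_0 = 1, q_1 = a_1, q_{n+1} = a_{n+1} q_n + q_{n−1}. Let K₁ > 0 and let (α_n)_{n≥0} be a sequence in (0,1] such that for all sufficiently large n, α_n ≥ K₁ · α_{n−1}^{(1−ℓ^{−a_{n+1}})/(ℓ−1)} · α_{n−2}^{ℓ^{−a_n}}. Then there exist constants K > 0 and C ∈ (0,1) such that for all sufficiently large n, −log α_n ≤ K·Cⁿ·q_{n+1}. -/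
open Filter

/-- Denominators of the convergents of the continued fraction `[0; a 1, a 2, …]`:
`q 0 = 1`, `q 1 = a 1`, `q (n+2) = a (n+2) * q (n+1) + q n`. -/
def qrec (a : ℕ → ℕ) : ℕ → ℕ
  | 0 => 1
  | 1 => a 1
  | n + 2 => a (n + 2) * qrec a (n + 1) + qrec a n

theorem one_le_qrec {a : ℕ → ℕ} (ha : ∀ n ≥ 1, 1 ≤ a n) : ∀ n, 1 ≤ qrec a n
  | 0 => le_rfl
  | 1 => ha 1 le_rfl
  | n + 2 => (one_le_qrec ha n).trans (Nat.le_add_left _ _)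

theorem qrec_le_succ {a : ℕ → ℕ} (ha : ∀ n ≥ 1, 1 ≤ a n) : ∀ n, qrec a n ≤ qrec a (n + 1)
  | 0 => ha 1 le_rfl
  | n + 1 => by
    have h := Nat.mul_le_mul_right (qrec a (n + 1)) (ha (n + 2) (by omega))
    simp only [qrec]
    omega

theorem two_mul_qrec_le {a : ℕ → ℕ} (ha : ∀ n ≥ 1, 1 ≤ a n) (n : ℕ) :
    2 * qrec a n ≤ qrec a (n + 2) := by
  have h := Nat.mul_le_mul_right (qrec a (n + 1)) (ha (n + 2) (by omega))
  have h' := qrec_le_succ ha n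
  simp only [qrec]
  omega

/-- Since `qrec a` at least doubles in two steps, it absorbs a geometric decay of ratio `C`
with `1 ≤ 2 * C ^ 2`. -/
theorem one_le_pow_mul_qrec_succ {a : ℕ → ℕ} (ha : ∀ n ≥ 1, 1 ≤ a n) {C : ℝ}
    (hC : 1 / 2 ≤ C) (hC2 : 1 ≤ 2 * C ^ 2) : ∀ n, 1 ≤ C ^ n * (qrec a (n + 1) : ℝ)
  | 0 => by simpa using one_le_qrec ha 1
  | 1 => by
    have h : (2 : ℝ) ≤ qrec a 2 := by
      exact_mod_cast (two_mul_qrec_le ha 0)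
    simp only [pow_one, Nat.reduceAdd]
    nlinarith
  | n + 2 => by
    have ih := one_le_pow_mul_qrec_succ ha hC hC2 n
    have h : (2 : ℝ) * qrec a (n + 1) ≤ qrec a (n + 3) := by
      exact_mod_cast two_mul_qrec_le ha (n + 1)
    have hCn : 0 ≤ C ^ (n + 2) := by positivity
    calc 1 ≤ 2 * C ^ 2 * (C ^ n * (qrec a (n + 1) : ℝ)) := one_le_mul_of_one_le_of_one_le hC2 ih
      _ = C ^ (n + 2) * (2 * qrec a (n + 1)) := by ring
      _ ≤ C ^ (n + 2) * (qrec a (n + 3) : ℝ) := mul_le_mul_of_nonneg_left h hCn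

theorem one_sub_rpow_neg_div_le {ℓ : ℝ} (hℓ : 1 < ℓ) (n : ℕ) :
    (1 - ℓ ^ (-(n : ℝ))) / (ℓ - 1) ≤ ℓ⁻¹ * n := by
  have h0 : 0 < ℓ := by linarith
  have hB := one_add_mul_le_pow (a := ℓ⁻¹ - 1) (by linarith [inv_pos.2 h0]) n
  rw [add_sub_cancel] at hB
  rw [Real.rpow_neg h0.le, Real.rpow_natCast, ← inv_pow, div_le_iff₀ (by linarith)]
  have h1 : ℓ⁻¹ * n * (ℓ - 1) = n * (1 - ℓ⁻¹) := by field_simp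
  linarith

theorem rpow_neg_natCast_le_inv {ℓ : ℝ} (hℓ : 1 ≤ ℓ) {n : ℕ} (hn : 1 ≤ n) :
    ℓ ^ (-(n : ℝ)) ≤ ℓ⁻¹ := by
  rw [← Real.rpow_neg_one]
  exact Real.rpow_le_rpow_of_exponent_le hℓ (neg_le_neg (by exact_mod_cast hn))

/-- A nonnegative sequence satisfying the recursion of `qrec a` up to a factor `r < 1` and an
additive constant grows exponentially slower than `qrec a`. -/
theorem exists_le_mul_pow_mul_qrec {a : ℕ → ℕ} (ha : ∀ n ≥ 1, 1 ≤ a n) {r k : ℝ}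
    (hr : r ∈ Set.Ioo (0 : ℝ) 1) (hk : 0 ≤ k) {x : ℕ → ℝ} (hx : ∀ n, 0 ≤ x n)
    (hrec : ∀ᶠ n in atTop, x (n + 2) ≤ k + r * (a (n + 3) * x (n + 1) + x n)) :
    ∃ K > 0, ∃ C ∈ Set.Ioo (0 : ℝ) 1, ∀ᶠ n in atTop,
      x n ≤ K * C ^ n * (qrec a (n + 1) : ℝ) := by
  obtain ⟨hr0, hr1⟩ := hr
  obtain ⟨N, hN⟩ := eventually_atTop.1 hrec
  obtain ⟨C, hC⟩ : ∃ C, C = 1 - (1 - r) / 8 := ⟨_, rfl⟩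
  have hC0 : 1 / 2 ≤ C := by linarith
  have hC1 : C < 1 := by linarith
  have hC2 : 1 ≤ 2 * C ^ 2 := by nlinarith
  have hd : 0 < C ^ 2 - r := by nlinarith
  have hY := one_le_pow_mul_qrec_succ ha hC0 hC2
  obtain ⟨K, hK⟩ : ∃ K, K = x N + x (N + 1) + k / (C ^ 2 - r) + 1 := ⟨_, rfl⟩
  have hkd : 0 ≤ k / (C ^ 2 - r) := by positivity
  have hK0 : 0 < K := by linarith [hx N, hx (N + 1)]
  have hkK : k ≤ K * (C ^ 2 - r) := by
    rw [← div_le_iff₀ hd]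
    linarith [hx N, hx (N + 1)]
  have hbase : ∀ n, x n ≤ K → x n ≤ K * C ^ n * (qrec a (n + 1) : ℝ) := fun n h => by
    rw [mul_assoc]
    exact h.trans (le_mul_of_one_le_right hK0.le (hY n))
  have key : ∀ m ≥ N, x m ≤ K * C ^ m * (qrec a (m + 1) : ℝ) ∧
      x (m + 1) ≤ K * C ^ (m + 1) * (qrec a (m + 2) : ℝ) := by
    intro m hm
    induction m, hm using Nat.le_induction with
    | base =>
      exact ⟨hbase N (by linarith [hx (N + 1)]), hbase (N + 1) (by linarith [hx N])⟩
    | succ m hm ih =>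
      obtain ⟨h1, h2⟩ := ih
      refine ⟨h2, ?_⟩
      have hq : (qrec a (m + 3) : ℝ) = a (m + 3) * qrec a (m + 2) + qrec a (m + 1) := by
        simp [qrec]
      have hCm : 0 < C ^ m := by positivity
      have hbig : 1 ≤ C ^ m * (qrec a (m + 3) : ℝ) := by
        refine (hY (m + 2)).trans ?_
        gcongr ?_ * _
        exact pow_le_pow_of_le_one (by linarith) hC1.le (by omega)
      have h2' : x (m + 1) ≤ K * C ^ m * (qrec a (m + 2) : ℝ) := by
        refine h2.trans ?_
        gcongr K * ?_ * _
        exact pow_le_pow_of_le_one (by linarith) hC1.le (by omega)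
      calc x (m + 2) ≤ k + r * (a (m + 3) * x (m + 1) + x m) := hN m hm
        _ ≤ k + r * (a (m + 3) * (K * C ^ m * (qrec a (m + 2) : ℝ))
              + K * C ^ m * (qrec a (m + 1) : ℝ)) := by gcongr
        _ = k + r * K * (C ^ m * (qrec a (m + 3) : ℝ)) := by rw [hq]; ring
        _ ≤ K * (C ^ 2 - r) * (C ^ m * (qrec a (m + 3) : ℝ))
              + r * K * (C ^ m * (qrec a (m + 3) : ℝ)) := by
          gcongr
          exact hkK.trans (le_mul_of_one_le_right (by positivity) hbig)
        _ = K * C ^ (m + 2) * (qrec a (m + 3) : ℝ) := by ring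
  exact ⟨K, hK0, C, ⟨by linarith, hC1⟩, eventually_atTop.2 ⟨N, fun m hm => (key m hm).1⟩⟩

/-- if `ℓ ∈ (1,2]`, the `a_n ≤ M` and the sequence `α_n ∈ (0,1]` satisfies
`α_n ≥ K₁ · α_{n-1}^{(1-ℓ^{-a_{n+1}})/(ℓ-1)} · α_{n-2}^{ℓ^{-a_n}}` for all large `n`,
then there are `K > 0` and `C ∈ (0,1)` with `−log α_n ≤ K·Cⁿ·q_{n+1}` for all large `n`. -/
theorem neg_log_alpha_bound (ℓ : ℝ) (hℓ : ℓ ∈ Set.Ioc (1 : ℝ) 2)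
    (M : ℕ) (hM : 0 < M) (a : ℕ → ℕ) (ha : ∀ n ≥ 1, 1 ≤ a n ∧ a n ≤ M)
    (K₁ : ℝ) (hK₁ : 0 < K₁)
    (α : ℕ → ℝ) (hα : ∀ n, α n ∈ Set.Ioc (0 : ℝ) 1)
    (hrec : ∀ᶠ n in atTop,
      K₁ * α (n - 1) ^ ((1 - ℓ ^ (-(a (n + 1) : ℝ))) / (ℓ - 1))
        * α (n - 2) ^ (ℓ ^ (-(a n : ℝ))) ≤ α n) :
    ∃ K > 0, ∃ C ∈ Set.Ioo (0 : ℝ) 1, ∀ᶠ n in atTop,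
      -Real.log (α n) ≤ K * C ^ n * (qrec a (n + 1) : ℝ) := by
  have ha' : ∀ n ≥ 1, 1 ≤ a n := fun n hn => (ha n hn).1
  have hℓ0 : 0 < ℓ := by linarith [hℓ.1]
  have hx : ∀ n, 0 ≤ -Real.log (α n) := fun n =>
    neg_nonneg.2 (Real.log_nonpos (hα n).1.le (hα n).2)
  refine exists_le_mul_pow_mul_qrec ha' (k := |Real.log K₁|)
    ⟨inv_pos.2 hℓ0, inv_lt_one_of_one_lt₀ hℓ.1⟩ (abs_nonneg _) hx ?_
  filter_upwards [(tendsto_add_atTop_nat 2).eventually hrec] with n hn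
  have hα0 := fun m => (hα m).1
  have hlog := Real.log_le_log (mul_pos (mul_pos hK₁ (Real.rpow_pos_of_pos (hα0 _) _))
    (Real.rpow_pos_of_pos (hα0 _) _)) hn
  rw [Real.log_mul (mul_pos hK₁ (Real.rpow_pos_of_pos (hα0 _) _)).ne'
    (Real.rpow_pos_of_pos (hα0 _) _).ne', Real.log_mul hK₁.ne'
    (Real.rpow_pos_of_pos (hα0 _) _).ne', Real.log_rpow (hα0 _), Real.log_rpow (hα0 _)] at hlog
  simp only [Nat.add_sub_cancel, show n + 2 - 1 = n + 1 by omega,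
    show n + 2 + 1 = n + 3 by omega] at hlog
  have h1 := mul_le_mul_of_nonneg_right (one_sub_rpow_neg_div_le hℓ.1 (a (n + 3))) (hx (n + 1))
  have h2 := mul_le_mul_of_nonneg_right
    (rpow_neg_natCast_le_inv hℓ.1.le (ha' (n + 2) (by omega))) (hx n)
  linarith [neg_abs_le (Real.log K₁)]
end
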